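/- arXiv:2601.17395 — 4 statements merged into one kernel-verified Lean document; each statement's English description precedes it below -/
import Mathlib

section
/- Let F be a field, let Σ be the L_ring(F)-theory of all field extensions of F, and let n ≥ 1. Then every ∃_n∃_1-L_ring(F)-sentence φ has essential fiber dimension efd_Σ(φ) ≤ n; in particular, if φ holds in a field extension E of F, then φ holds in some subextension E₀ of E/F with trdeg(E₀/F) ≤ n. -/
open FirstOrder FirstOrder.Language

universe u v w x

namespace Paper



/-! ### Syntactic fragments -/

/-- `IsExistsN n φ`: `φ` is an `∃_n`-formula, i.e. of the form `∃ x₁ … x_m ψ`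
with `m ≤ n` and `ψ` quantifier-free. -/
inductive IsExistsN {L : Language} {α : Type*} : ℕ → ∀ {k : ℕ}, L.BoundedFormula α k → Prop
  | qf {n k : ℕ} {φ : L.BoundedFormula α k} : φ.IsQF → IsExistsN n φ
  | ex {n k : ℕ} {φ : L.BoundedFormula α (k + 1)} : IsExistsN n φ → IsExistsN (n + 1) φ.ex

/-- `φ` is an existential formula. -/
def IsExists {L : Language} {α : Type*} {k : ℕ} (φ : L.BoundedFormula α k) : Prop :=
  ∃ n : ℕ, IsExistsN n φ

/-- Positive boolean combinations of formulas satisfying `P`. -/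
inductive IsPosBC {L : Language} {α : Type*} (P : ∀ {k : ℕ}, L.BoundedFormula α k → Prop) :
    ∀ {k : ℕ}, L.BoundedFormula α k → Prop
  | base {k : ℕ} {φ : L.BoundedFormula α k} : P φ → IsPosBC P φ
  | inf {k : ℕ} {φ ψ : L.BoundedFormula α k} :
      IsPosBC P φ → IsPosBC P ψ → IsPosBC P (φ ⊓ ψ)
  | sup {k : ℕ} {φ ψ : L.BoundedFormula α k} :
      IsPosBC P φ → IsPosBC P ψ → IsPosBC P (φ ⊔ ψ)

/-- The `∃₁`-fragment: positive boolean combinations of formulas of the form `η` or `∃ y η`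
with `η` quantifier-free. -/
def IsE1 {L : Language} {α : Type*} {k : ℕ} (φ : L.BoundedFormula α k) : Prop :=
  IsPosBC (fun {k} φ => φ.IsQF ∨ ∃ ψ : L.BoundedFormula α (k + 1), ψ.IsQF ∧ φ = ψ.ex) φ

/-- `∃_n∃₁`-formulas: `∃ x₁ … x_m ψ` with `m ≤ n` and `ψ` in the `∃₁`-fragment. -/
inductive IsExistsNE1 {L : Language} {α : Type*} : ℕ → ∀ {k : ℕ}, L.BoundedFormula α k → Prop
  | e1 {n k : ℕ} {φ : L.BoundedFormula α k} : IsE1 φ → IsExistsNE1 n φ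
  | ex {n k : ℕ} {φ : L.BoundedFormula α (k + 1)} : IsExistsNE1 n φ → IsExistsNE1 (n + 1) φ.ex

/-- The `∃^n`-fragments, defined inductively: `∃^0`-formulas are the quantifier-free ones,
and an `∃^{n+1}`-formula is of the form `ψ` or `∃ x ψ` with `ψ` a positive boolean
combination of `∃^n`-formulas. -/
def IsExpN {L : Language} {α : Type*} : ℕ → ∀ {k : ℕ}, L.BoundedFormula α k → Prop
  | 0, _, φ => φ.IsQF
  | n + 1, k, φ => IsPosBC (IsExpN n) φ ∨
      ∃ ψ : L.BoundedFormula α (k + 1), IsPosBC (IsExpN n) ψ ∧ φ = ψ.ex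



/-! ### The language of rings with constants, and realization -/

/-- The `Language.ring`-structure on a ring. -/
noncomputable def ringStructure (M : Type*) [CommRing M] : Language.ring.Structure M :=
  (FirstOrder.Ring.compatibleRingOfRing M).toStructure

/-- The `L_ring(α)`-structure on a ring `M` with constants interpreted via `f : α → M`. -/
noncomputable def ringConStructure {α M : Type*} [CommRing M] (f : α → M) :
    (Language.ring[[α]]).Structure M :=
  letI := ringStructure M
  letI := constantsOn.structure f
  inferInstance

/-- `M ⊨ φ` for an `L_ring(α)`-sentence, with constants interpreted via `f`. -/
def RealizeRing (M : Type*) [CommRing M] {α : Type*} (f : α → M)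
    (φ : (Language.ring[[α]]).Sentence) : Prop :=
  @Sentence.Realize _ M (ringConStructure f) φ

/-- The unary relation symbol `O` for the valuation ring. -/
inductive ValRel : ℕ → Type
  | isO : ValRel 1

/-- The language with a single unary predicate `O`. -/
def oLang : Language := ⟨fun _ => Empty, ValRel⟩

/-- The language of valued fields `L_val = L_ring ∪ {O}`. -/
abbrev Lval : Language := Language.ring.sum oLang

/-- The `oLang`-structure on `M` in which `O` is interpreted as the set `O`. -/
def oStructure {M : Type*} (O : Set M) : oLang.Structure M where
  funMap := fun f _ => f.elim
  RelMap := fun {_} r => match r with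
    | .isO => fun xs => xs 0 ∈ O

/-- The `L_val(α)`-structure on a ring `M`, with `O` interpreted as the set `O` and
constants interpreted via `f : α → M`. -/
noncomputable def valConStructure {α M : Type*} [CommRing M] (O : Set M) (f : α → M) :
    (Lval[[α]]).Structure M :=
  letI := ringStructure M
  letI := oStructure O
  letI : Lval.Structure M := inferInstance
  letI := constantsOn.structure f
  inferInstance

/-- `M ⊨ φ` for an `L_val(α)`-sentence. -/
def RealizeVal (M : Type*) [CommRing M] (O : Set M) {α : Type*} (f : α → M)
    (φ : (Lval[[α]]).Sentence) : Prop :=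
  @Sentence.Realize _ M (valConStructure O f) φ



abbrev Zm0 : Type := WithZero (Multiplicative ℤ)

variable {K : Type*} [Field K] {Γ : Type*} [LinearOrderedCommGroupWithZero Γ]

/-- `π` is a uniformizer of `(K, v)`: `v π` is minimal positive
(multiplicatively: `0 < v π < 1` and `v π` is the largest value `< 1`). -/
def IsUniformizer (v : Valuation K Γ) (π : K) : Prop :=
  0 < v π ∧ v π < 1 ∧ ∀ x : K, v x < 1 → v x ≤ v π

/-- The valuation ring of `v`, as a set. -/
def Oset (v : Valuation K Γ) : Set K := {x | v x ≤ 1}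

/-- The residue field `Kv` of the valued field `(K, v)`. -/
abbrev ResF (v : Valuation K Γ) : Type _ :=
  IsLocalRing.ResidueField v.valuationSubring

/-- The residue map `O_v → Kv`. -/
abbrev resMap (v : Valuation K Γ) : v.valuationSubring →+* ResF v :=
  IsLocalRing.residue _

/-- `(K, v)` is a henselian valued field. -/
abbrev IsHenselian (v : Valuation K Γ) : Prop :=
  HenselianLocalRing v.valuationSubring

/-- compatibility of a ring homomorphism between residue fields with the residue maps,
for an extension `(K, v)` of `(C, u)`. -/
def ResCompat {C : Type*} [Field C] {Γ₀ : Type*} [LinearOrderedCommGroupWithZero Γ₀]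
    (u : Valuation C Γ₀) [Algebra C K] (v : Valuation K Γ)
    (g : ResF u →+* ResF v) : Prop :=
  ∀ (x : u.valuationSubring) (hx : algebraMap C K ↑x ∈ v.valuationSubring),
    g (resMap u x) = resMap v ⟨algebraMap C K ↑x, hx⟩

/-- `(K, v)` is complete (with respect to the valuation uniformity). -/
def IsCompleteValued (v : Valuation K Γ) : Prop :=
  letI : Valued K Γ := Valued.mk' v
  CompleteSpace K



/-- `E/F` admits a separating transcendence basis. -/
def HasSepTransBasis (F E : Type*) [Field F] [Field E] [Algebra F E] : Prop :=
  ∃ s : Set E, AlgebraicIndependent F ((↑) : s → E) ∧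
    Algebra.IsSeparable (IntermediateField.adjoin F s) E

/-- The field extension `E/F` is separable: every finitely generated subextension
admits a separating transcendence basis. -/
def IsSepExt (F E : Type*) [Field F] [Field E] [Algebra F E] : Prop :=
  ∀ s : Finset E, HasSepTransBasis F (IntermediateField.adjoin F (s : Set E))

/-- The extension given by a ring homomorphism `f : F →+* E` of fields is separable. -/
def IsSepExtHom {F E : Type*} [Field F] [Field E] (f : F →+* E) : Prop :=
  letI := f.toAlgebra
  IsSepExt F E

/-- `trdeg(E/F) ≤ d`: there is a finite transcendence basis with at most `d` elements. -/
def TrdegLE (F E : Type*) [CommRing F] [CommRing E] [Algebra F E] (d : ℕ) : Prop :=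
  ∃ s : Finset E, s.card ≤ d ∧ IsTranscendenceBasis F (Subtype.val : ((s : Set E)) → E)

/-- `F` is a large field: `F` is existentially closed in `F((t))`. -/
def LargeField (F : Type u) [Field F] : Prop :=
  ∀ φ : (Language.ring[[F]]).Sentence, IsExists φ →
    RealizeRing (LaurentSeries F) (algebraMap F (LaurentSeries F)) φ →
    RealizeRing F (id : F → F) φ

/-- `(R4_n)`: whenever a valuation `w` on a field `E` is trivial on a large subfield `F` of `E`
with residue field `Eu = F` (via the residue map), every `∃_n`-`L_ring(F)`-sentence true in `E`
is true in `F`. -/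
def R4N (n : ℕ) : Prop :=
  ∀ (E : Type u) [Field E] (Γ : Type u) [LinearOrderedCommGroupWithZero Γ]
    (w : Valuation E Γ) (F : Subfield E),
    LargeField.{u} F →
    (∀ y : F, (y : E) ≠ 0 → w y = 1) →
    (∀ y : E, w y ≤ 1 → ∃ x : F, w (y - x) < 1) →
    ∀ φ : (Language.ring[[F]]).Sentence, IsExistsN n φ →
      RealizeRing E ((↑) : F → E) φ → RealizeRing F (id : F → F) φ

/-- Excellence of the valuation ring of an (equicharacteristic, `ℤ`-valued) valued field
`(C, u)`, via the characterization: the fraction field of the completion (i.e. the completion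
of `C`) is a separable extension of `C`. -/
def ExcellentCompletion (C : Type u) [Field C] (u : Valuation C Zm0) : Prop :=
  letI : Valued C Zm0 := Valued.mk' u
  letI : Field (UniformSpace.Completion C) := UniformSpace.Completion.instField
  IsSepExtHom (UniformSpace.Completion.coeRingHom : C →+* UniformSpace.Completion C)


/-- `Th_P(K, fK) ⊆ Th_P(L, fL)`: every positive boolean combination of `L_ring(α)`-sentences
of the fragment `P` that is true in `K` is true in `L`. -/
def ThRingSub {α : Type*} (P : ∀ {k : ℕ}, (Language.ring[[α]]).BoundedFormula Empty k → Prop)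
    (K : Type*) [CommRing K] (fK : α → K) (L : Type*) [CommRing L] (fL : α → L) : Prop :=
  ∀ φ : (Language.ring[[α]]).Sentence, IsPosBC P φ →
    RealizeRing K fK φ → RealizeRing L fL φ

/-- `Th_P(K, OK, fK) ⊆ Th_P(L, OL, fL)` for `L_val(α)`-sentences. -/
def ThValSub {α : Type*} (P : ∀ {k : ℕ}, (Lval[[α]]).BoundedFormula Empty k → Prop)
    (K : Type*) [CommRing K] (OK : Set K) (fK : α → K)
    (L : Type*) [CommRing L] (OL : Set L) (fL : α → L) : Prop :=
  ∀ φ : (Lval[[α]]).Sentence, IsPosBC P φ →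
    RealizeVal K OK fK φ → RealizeVal L OL fL φ

end Paper

namespace Paper

/-- `efd_T(φ) ≤ d` for `T` a set of `L_ring(F)`-sentences, where the models considered are the
field extensions of `F` satisfying `T`:  whenever `φ` holds in such a model `E`, there is a
subextension `E₀` of `E/F` of transcendence degree at most `d` such that `φ` holds in every
model of `T` into which `E₀` embeds over `F`. -/
def EfdLE (F : Type u) [Field F] (T : Set ((Language.ring[[F]]).Sentence))
    (φ : (Language.ring[[F]]).Sentence) (d : ℕ) : Prop :=
  ∀ (E : Type v) [Field E] [Algebra F E],
    (∀ ψ ∈ T, RealizeRing E (algebraMap F E) ψ) → RealizeRing E (algebraMap F E) φ →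
    ∃ E₀ : IntermediateField F E, TrdegLE F E₀ d ∧
      ∀ (M : Type w) [Field M] [Algebra F M],
        (∀ ψ ∈ T, RealizeRing M (algebraMap F M) ψ) → Nonempty (↥E₀ →ₐ[F] M) →
        RealizeRing M (algebraMap F M) φ

/-- The `L_ring(F)`-structure on an `F`-algebra. -/
noncomputable abbrev algebraStructure (F M : Type*) [CommRing F] [CommRing M] [Algebra F M] :
    (Language.ring[[F]]).Structure M :=
  ringConStructure (algebraMap F M)

attribute [local instance] algebraStructure

/-- An algebra homomorphism is a homomorphism of `L_ring(F)`-structures. -/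
noncomputable def algHomToHom {F M N : Type*} [CommRing F] [CommRing M] [CommRing N] [Algebra F M]
    [Algebra F N] (g : M →ₐ[F] N) : M →[Language.ring[[F]]] N where
  toFun := g
  map_fun' := by
    intro k f xs
    rcases f with f | f
    · cases f
      · exact (map_add g (xs 0) (xs 1))
      · exact (map_mul g (xs 0) (xs 1))
      · exact (map_neg g (xs 0))
      · exact map_zero g
      · exact map_one g
    · cases k with
      | zero => exact g.commutes f
      | succ k => exact f.elim
  map_rel' := by
    intro k r
    rcases r with r | r <;> exact r.elim

/-- An injective algebra homomorphism is an embedding of `L_ring(F)`-structures. -/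
noncomputable def algHomToEmbedding {F M N : Type*} [CommRing F] [CommRing M] [CommRing N]
    [Algebra F M] [Algebra F N] (g : M →ₐ[F] N) (hg : Function.Injective g) :
    M ↪[Language.ring[[F]]] N where
  toFun := g
  inj' := hg
  map_fun' := (algHomToHom g).map_fun'
  map_rel' := by
    intro k r
    rcases r with r | r <;> exact r.elim

/-- A quantifier-free formula over a polynomial ring in one variable over a domain holds if and
only if it holds after specialization at all but finitely many points. -/
theorem finite_setOf_not_realize_eval_iff {F R : Type*} [Field F] [CommRing R] [IsDomain R]
    [Algebra F R] {α : Type*} {k : ℕ} {φ : (Language.ring[[F]]).BoundedFormula α k} (hφ : φ.IsQF)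
    (v : α → Polynomial R) (xs : Fin k → Polynomial R) :
    {c : R | ¬ (φ.Realize (fun i => (v i).eval c) (fun i => (xs i).eval c) ↔
      φ.Realize v xs)}.Finite := by
  induction hφ with
  | falsum => simp [BoundedFormula.Realize]
  | of_isAtomic h =>
    induction h with
    | equal t₁ t₂ =>
      have key (t : (Language.ring[[F]]).Term (α ⊕ Fin k)) (c : R) :
          t.realize (Sum.elim (fun i => (v i).eval c) (fun i => (xs i).eval c)) =
            (t.realize (Sum.elim v xs)).eval c := by
        have := HomClass.realize_term
          (algHomToHom ((Polynomial.aeval c).restrictScalars F : Polynomial R →ₐ[F] R))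
          (t := t) (v := Sum.elim v xs)
        rw [Sum.comp_elim] at this
        exact this
      simp only [BoundedFormula.realize_bdEqual, key]
      by_cases h : t₁.realize (Sum.elim v xs) = t₂.realize (Sum.elim v xs)
      · simp [h]
      · refine (Polynomial.finite_setOfPred_isRoot (sub_ne_zero.2 h)).subset fun c hc => ?_
        simpa [h, sub_eq_zero] using hc
    | rel R ts => rcases R with R | R <;> exact R.elim
  | imp _ _ ih₁ ih₂ =>
    refine (ih₁.union ih₂).subset fun c hc => ?_
    simp only [Set.mem_ofPred_eq, BoundedFormula.realize_imp, Set.mem_union] at hc ⊢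
    tauto

/-- An existential quantifier over a quantifier-free formula with parameters in an intermediate
field can be witnessed in that field by any transcendental witness, if the field is infinite. -/
theorem realize_ex_of_forall_notMem {F E : Type*} [Field F] [Field E] [Algebra F E]
    {E₀ : IntermediateField F E} (hE₀ : ∀ x ∉ E₀, Transcendental E₀ x ∧ Infinite E₀)
    {α : Type*} {k : ℕ} {φ : (Language.ring[[F]]).BoundedFormula α (k + 1)} (hφ : φ.IsQF)
    (v : α → E₀) (xs : Fin k → E₀)
    (h : φ.ex.Realize (fun i => (v i : E)) (fun i => (xs i : E))) : φ.ex.Realize v xs := by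
  obtain ⟨b, hb⟩ := BoundedFormula.realize_ex.1 h
  rw [BoundedFormula.realize_ex]
  by_cases hbE : b ∈ E₀
  · refine ⟨⟨b, hbE⟩, ?_⟩
    rw [← hφ.realize_embedding (algHomToEmbedding E₀.val E₀.val.injective)]
    rw [Fin.comp_snoc]
    exact hb
  · obtain ⟨hb', _⟩ := hE₀ b hbE
    have hX : φ.Realize (fun i => Polynomial.C (v i))
        (Fin.snoc (fun i => Polynomial.C (xs i)) Polynomial.X) := by
      rw [← hφ.realize_embedding (algHomToEmbedding
        ((Polynomial.aeval b).restrictScalars F : Polynomial E₀ →ₐ[F] E)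
        (transcendental_iff_injective.1 hb'))]
      convert hb using 1
      · funext i
        exact Polynomial.aeval_C b (v i)
      · rw [Fin.comp_snoc]
        congr 1
        · funext i
          exact Polynomial.aeval_C b (xs i)
        · exact Polynomial.aeval_X b
    obtain ⟨c, hc⟩ := (finite_setOf_not_realize_eval_iff hφ
      (fun i => (Polynomial.C (v i) : Polynomial E₀))
      (Fin.snoc (fun i => Polynomial.C (xs i)) Polynomial.X)).infinite_compl.nonempty
    refine ⟨c, ?_⟩
    have := (not_not.1 hc).2 hX
    convert this using 1
    · simp
    · funext i
      refine Fin.lastCases ?_ (fun j => ?_) i <;> simp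

/-- `IsE1`-formulas descend to infinite relatively algebraically closed subfields. -/
theorem IsE1.realize_of_forall_notMem {F E : Type*} [Field F] [Field E] [Algebra F E]
    {E₀ : IntermediateField F E} (hE₀ : ∀ x ∉ E₀, Transcendental E₀ x ∧ Infinite E₀)
    {α : Type*} {k : ℕ} {φ : (Language.ring[[F]]).BoundedFormula α k} (hφ : IsE1 φ)
    (v : α → E₀) (xs : Fin k → E₀)
    (h : φ.Realize (fun i => (v i : E)) (fun i => (xs i : E))) : φ.Realize v xs := by
  unfold IsE1 at hφ
  induction hφ with
  | base h₁ =>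
    rcases h₁ with h₁ | ⟨ψ, h₁, rfl⟩
    · rwa [← h₁.realize_embedding (algHomToEmbedding E₀.val E₀.val.injective)]
    · exact realize_ex_of_forall_notMem hE₀ h₁ v xs h
  | inf _ _ ih₁ ih₂ =>
    rw [BoundedFormula.realize_inf] at h ⊢
    exact ⟨ih₁ h.1, ih₂ h.2⟩
  | sup _ _ ih₁ ih₂ =>
    rw [BoundedFormula.realize_sup] at h ⊢
    exact h.imp ih₁ ih₂

/-- `IsE1`-formulas are preserved by injective algebra homomorphisms. -/
theorem IsE1.realize_algHom {F M N : Type*} [CommRing F] [CommRing M] [CommRing N] [Algebra F M]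
    [Algebra F N] (g : M →ₐ[F] N) (hg : Function.Injective g)
    {α : Type*} {k : ℕ} {φ : (Language.ring[[F]]).BoundedFormula α k} (hφ : IsE1 φ)
    (v : α → M) (xs : Fin k → M) (h : φ.Realize v xs) : φ.Realize (g ∘ v) (g ∘ xs) := by
  unfold IsE1 at hφ
  induction hφ with
  | base h₁ =>
    rcases h₁ with h₁ | ⟨ψ, h₁, rfl⟩
    · exact (h₁.realize_embedding (algHomToEmbedding g hg)).2 h
    · obtain ⟨b, hb⟩ := BoundedFormula.realize_ex.1 h
      refine BoundedFormula.realize_ex.2 ⟨g b, ?_⟩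
      rw [← Fin.comp_snoc]
      exact (h₁.realize_embedding (algHomToEmbedding g hg)).2 hb
  | inf _ _ ih₁ ih₂ =>
    rw [BoundedFormula.realize_inf] at h ⊢
    exact ⟨ih₁ h.1, ih₂ h.2⟩
  | sup _ _ ih₁ ih₂ =>
    rw [BoundedFormula.realize_sup] at h ⊢
    exact h.imp ih₁ ih₂

/-- `IsExistsNE1`-formulas are preserved by injective algebra homomorphisms. -/
theorem IsExistsNE1.realize_algHom {F M N : Type*} [CommRing F] [CommRing M] [CommRing N]
    [Algebra F M] [Algebra F N] (g : M →ₐ[F] N) (hg : Function.Injective g)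
    {α : Type*} {n k : ℕ} {φ : (Language.ring[[F]]).BoundedFormula α k} (hφ : IsExistsNE1 n φ)
    (v : α → M) (xs : Fin k → M) (h : φ.Realize v xs) : φ.Realize (g ∘ v) (g ∘ xs) := by
  induction hφ with
  | e1 h₁ => exact h₁.realize_algHom g hg v xs h
  | ex _ ih =>
    obtain ⟨b, hb⟩ := BoundedFormula.realize_ex.1 h
    refine BoundedFormula.realize_ex.2 ⟨g b, ?_⟩
    rw [← Fin.comp_snoc]
    exact ih _ hb

/-- An `IsExistsNE1`-formula that holds in `E` also holds in every infinite relatively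
algebraically closed subfield containing suitable elements `t`, at most `n` in number. -/
theorem IsExistsNE1.exists_finset_realize {F E : Type*} [Field F] [Field E] [Algebra F E]
    {α : Type*} {n k : ℕ} {φ : (Language.ring[[F]]).BoundedFormula α k} (hφ : IsExistsNE1 n φ)
    (v : α → E) (xs : Fin k → E) (h : φ.Realize v xs) :
    ∃ t : Finset E, t.card ≤ n ∧ ∀ E₀ : IntermediateField F E,
      (∀ x ∉ E₀, Transcendental E₀ x ∧ Infinite E₀) → (t : Set E) ⊆ E₀ →
      ∀ (v' : α → E₀) (xs' : Fin k → E₀), (fun i => (v' i : E)) = v → (fun i => (xs' i : E)) = xs →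
        φ.Realize v' xs' := by
  classical
  induction hφ with
  | e1 h₁ =>
    refine ⟨∅, by simp, fun E₀ hE₀ _ v' xs' hv hxs => ?_⟩
    subst hv hxs
    exact h₁.realize_of_forall_notMem hE₀ v' xs' h
  | ex _ ih =>
    obtain ⟨b, hb⟩ := BoundedFormula.realize_ex.1 h
    obtain ⟨t, ht, H⟩ := ih _ hb
    refine ⟨insert b t, (Finset.card_insert_le b t).trans (by lia), ?_⟩
    intro E₀ hE₀ hsub v' xs' hv hxs
    rw [Finset.coe_insert, Set.insert_subset_iff] at hsub
    refine BoundedFormula.realize_ex.2 ⟨⟨b, hsub.1⟩, H E₀ hE₀ hsub.2 v' _ hv ?_⟩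
    subst hxs
    exact Fin.comp_snoc (fun x : E₀ => (x : E)) xs' ⟨b, hsub.1⟩

/-- If every element of `E₀` is algebraic over `F(t)` for some `t ⊆ E₀`, then `t` contains a
transcendence basis of `E₀` over `F`. -/
theorem exists_subset_isTranscendenceBasis {F E : Type*} [Field F] [Field E] [Algebra F E]
    (E₀ : IntermediateField F E) {t : Set E} (ht : t ⊆ E₀)
    (h : ∀ x ∈ E₀, IsAlgebraic (IntermediateField.adjoin F t) x) :
    ∃ s ⊆ ((↑) ⁻¹' t : Set E₀), IsTranscendenceBasis F ((↑) : s → E₀) := by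
  have : Algebra.IsAlgebraic (Algebra.adjoin F ((↑) ⁻¹' t : Set E₀)) E₀ := by
    let e := (Algebra.adjoin F ((↑) ⁻¹' t : Set E₀)).equivMapOfInjective E₀.val E₀.val.injective
    have hmap : (Algebra.adjoin F ((↑) ⁻¹' t : Set E₀)).map E₀.val = Algebra.adjoin F t := by
      rw [AlgHom.map_adjoin]
      congr 1
      exact (Subtype.image_preimage_coe _ _).trans (Set.inter_eq_right.2 ht)
    refine ⟨fun x => IsAlgebraic.of_ringHom_of_comp_eq e E₀.val ?_ e.surjective
      E₀.val.injective rfl⟩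
    rw [hmap, ← IntermediateField.isAlgebraic_adjoin_iff]
    exact h x x.2
  exact exists_isTranscendenceBasis_subset _

/-- A finite set `t` is contained in a relatively algebraically closed intermediate field of
transcendence degree at most the cardinality of `t`. -/
theorem exists_intermediateField_trdegLE {F E : Type*} [Field F] [Field E] [Algebra F E]
    (t : Finset E) : ∃ E₀ : IntermediateField F E, (t : Set E) ⊆ E₀ ∧ TrdegLE F E₀ t.card ∧
      ∀ x ∉ E₀, Transcendental E₀ x := by
  let L := IntermediateField.adjoin F (t : Set E)
  let E₀ := (algebraicClosure L E).restrictScalars F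
  have hsub : (t : Set E) ⊆ E₀ := fun x hx =>
    (algebraicClosure L E).algebraMap_mem ⟨x, IntermediateField.subset_adjoin F _ hx⟩
  refine ⟨E₀, hsub, ?_, fun x hx hx' => hx ?_⟩
  · obtain ⟨s, hst, hs⟩ := exists_subset_isTranscendenceBasis E₀ hsub
      fun x hx => mem_algebraicClosure_iff.1 hx
    have hinj : Set.InjOn ((↑) : E₀ → E) ((↑) ⁻¹' (t : Set E)) := Subtype.val_injective.injOn
    have hfin : Set.Finite ((↑) ⁻¹' (t : Set E) : Set E₀) := t.finite_toSet.preimage hinj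
    lift s to Finset E₀ using hfin.subset hst
    exact ⟨s, Finset.card_le_card_of_injOn _ hst Subtype.val_injective.injOn, hs⟩
  · have : IsAlgebraic (algebraicClosure L E) x := hx'
    exact mem_algebraicClosure_iff.2 (this.restrictScalars L)

/-- An `∃_n∃_1`-sentence with `1 ≤ n` that holds in `E` holds in some subextension of
transcendence degree at most `n`. -/
theorem IsExistsNE1.exists_intermediateField_realizeRing {F E : Type*} [Field F] [Field E]
    [Algebra F E] {n : ℕ} (hn : 1 ≤ n) {φ : (Language.ring[[F]]).Sentence}
    (hφ : IsExistsNE1 n φ) (h : RealizeRing E (algebraMap F E) φ) :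
    ∃ E₀ : IntermediateField F E, TrdegLE F E₀ n ∧ RealizeRing E₀ (algebraMap F E₀) φ := by
  obtain ⟨t, ht, H⟩ := hφ.exists_finset_realize default default h
  replace H (E₀ : IntermediateField F E) (h₁ : ∀ x ∉ E₀, Transcendental E₀ x ∧ Infinite E₀)
      (h₂ : (t : Set E) ⊆ E₀) : RealizeRing E₀ (algebraMap F E₀) φ :=
    H E₀ h₁ h₂ default default (Subsingleton.elim _ _) (Subsingleton.elim _ _)
  obtain ⟨s, hs, hts, hE⟩ : ∃ s : Finset E, s.card ≤ n ∧ (∀ x ∈ t, x ∈ s ∨ IsAlgebraic F x) ∧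
      ((∀ x : E, IsAlgebraic F x) ∨ ∃ w ∈ s, Transcendental F w) := by
    by_cases hE : ∀ x : E, IsAlgebraic F x
    · exact ⟨∅, by simp, fun x _ => .inr (hE x), .inl hE⟩
    by_cases htr : ∃ w ∈ t, Transcendental F w
    · exact ⟨t, ht, fun x hx => .inl hx, .inr htr⟩
    · simp only [Transcendental] at htr
      push Not at hE htr
      obtain ⟨u, hu⟩ := hE
      exact ⟨{u}, by simpa using hn, fun x hx => .inr (htr x hx), .inr ⟨u, by simp, hu⟩⟩
  obtain ⟨E₀, hsE, ⟨b, hb, hb'⟩, htr⟩ := exists_intermediateField_trdegLE (F := F) s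
  have hmem (x : E) (hx : IsAlgebraic F x) : x ∈ E₀ := by
    by_contra hxE
    exact htr x hxE (hx.tower_top E₀)
  refine ⟨E₀, ⟨b, hb.trans hs, hb'⟩, H E₀ (fun x hx => ⟨htr x hx, ?_⟩) fun x hx => ?_⟩
  · rcases hE with hE | ⟨w, hws, hw⟩
    · exact (hx (hmem x (hE x))).elim
    · by_contra hfin
      rw [not_infinite_iff_finite] at hfin
      have : Algebra.IsAlgebraic F E₀ := Algebra.IsAlgebraic.of_finite F E₀
      exact hw (IntermediateField.isAlgebraic_iff.1 (this.isAlgebraic (⟨w, hsE hws⟩ : E₀)))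
  · exact (hts x hx).elim (fun hx => hsE hx) (hmem x)

/-- Lemma `lem:efd` of the paper.
Let `F` be a field and `Σ` the `L_ring(F)`-theory of all field extensions of `F` (here: the
empty set of axioms, with models ranging over field extensions of `F`), and let `n ≥ 1`.
Then every `∃_n∃_1`-`L_ring(F)`-sentence `φ` has `efd_Σ(φ) ≤ n`; in particular, if `φ` holds
in a field extension `E` of `F`, then `φ` holds in some subextension `E₀` of `E/F` with
`trdeg(E₀/F) ≤ n`. -/
theorem statement11 (F : Type u) [Field F] (n : ℕ) (hn : 1 ≤ n)
    (φ : (Language.ring[[F]]).Sentence) (hφ : IsExistsNE1 n φ) :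
    EfdLE.{u, v, w} F (∅ : Set ((Language.ring[[F]]).Sentence)) φ n ∧
    ∀ (E : Type v) [Field E] [Algebra F E], RealizeRing E (algebraMap F E) φ →
      ∃ E₀ : IntermediateField F E, TrdegLE F E₀ n ∧
        RealizeRing E₀ (algebraMap F E₀) φ := by
  have main : ∀ (E : Type v) [Field E] [Algebra F E], RealizeRing E (algebraMap F E) φ →
      ∃ E₀ : IntermediateField F E, TrdegLE F E₀ n ∧
        RealizeRing E₀ (algebraMap F E₀) φ :=
    fun E _ _ h => hφ.exists_intermediateField_realizeRing hn h
  refine ⟨fun E _ _ _ h => ?_, main⟩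
  obtain ⟨E₀, hd, h₀⟩ := main E h
  refine ⟨E₀, hd, fun M _ _ _ ⟨g⟩ => ?_⟩
  have := hφ.realize_algHom g g.injective default default h₀
  rw [Subsingleton.elim (g ∘ default : Empty → M) default,
    Subsingleton.elim (g ∘ default : Fin 0 → M) default] at this
  exact this

end Paper
end

section
/- Let F be a field and let T be an L_ring(F)-theory all of whose models are separable field extensions of F. Then every existential L_ring(F)-sentence φ with efd_T(φ) ≤ n is equivalent modulo T to an ∃_{n+1}-L_ring(F)-sentence. -/
open FirstOrder FirstOrder.Language

universe u v w x

namespace Paper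

theorem map_funMap_pi {F : Type u} [Field F] {ι : Type x} {M : ι → Type v}
    [∀ i, Field (M i)] [∀ i, Algebra F (M i)] {N : Type w} [Field N] [Algebra F N]
    (π : (∀ i, M i) →ₐ[F] N) {k : ℕ} (f : (Language.ring[[F]]).Functions k)
    (y : Fin k → ∀ i, M i) :
    π (fun i => (ringConStructure (algebraMap F (M i))).funMap f fun j => y j i) =
      (ringConStructure (algebraMap F N)).funMap f fun j => π (y j) := by
  match k, f, y with
  | _, Sum.inl .add, y => exact map_add π (y 0) (y 1)
  | _, Sum.inl .mul, y => exact map_mul π (y 0) (y 1)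
  | _, Sum.inl .neg, y => exact map_neg π (y 0)
  | _, Sum.inl .zero, _ => exact map_zero π
  | _, Sum.inl .one, _ => exact map_one π
  | 0, Sum.inr a, _ => exact π.commutes a
  | 1, Sum.inr f, _ => exact f.elim
  | 2, Sum.inr f, _ => exact f.elim
  | _ + 3, Sum.inr f, _ => exact f.elim

theorem relations_isEmpty (α : Type*) (k : ℕ) : IsEmpty ((Language.ring[[α]]).Relations k) :=
  ⟨fun r => by rcases r with r | r <;> cases r⟩

/-- The ultraproduct of a family of field extensions of `F`, together with Łoś's theorem. -/
theorem exists_ultraproduct {F : Type u} [Field F] {ι : Type v} (U : Ultrafilter ι)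
    (M : ι → Type v) [∀ i, Field (M i)] [∀ i, Algebra F (M i)] :
    ∃ (N : Type v) (_ : Field N) (_ : Algebra F N) (π : (∀ i, M i) →ₐ[F] N),
      (∀ x y, π x = π y ↔ ∀ᶠ i in U, x i = y i) ∧
      ∀ φ : (Language.ring[[F]]).Sentence, RealizeRing N (algebraMap F N) φ ↔
        ∀ᶠ i in U, RealizeRing (M i) (algebraMap F (M i)) φ := by
  classical
  let I : Ideal (∀ i, M i) :=
    { carrier := {x | ∀ᶠ i in U, x i = 0}
      zero_mem' := Filter.Eventually.of_forall fun _ => rfl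
      add_mem' := fun {x y} hx hy => by
        filter_upwards [hx, hy] with i h₁ h₂
        simp [h₁, h₂]
      smul_mem' := fun c x hx => by
        filter_upwards [hx] with i h
        simp [h] }
  have hI : I.IsMaximal := by
    refine Ideal.isMaximal_iff.2 ⟨fun h => ?_, fun J x hIJ hx hxJ => ?_⟩
    · obtain ⟨i, hi⟩ := Filter.Eventually.exists (f := (U : Filter ι)) h
      exact one_ne_zero hi
    · have hx' : ∀ᶠ i in U, x i ≠ 0 := Ultrafilter.eventually_not.2 hx
      have h : (1 - x⁻¹ * x) ∈ J := hIJ (by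
        change ∀ᶠ i in U, (1 - x⁻¹ * x) i = 0
        filter_upwards [hx'] with i hi
        simp [hi])
      simpa using J.add_mem h (J.mul_mem_left x⁻¹ hxJ)
  let N := (∀ i, M i) ⧸ I
  let : Field N := Ideal.Quotient.field I
  let π : (∀ i, M i) →ₐ[F] N := Ideal.Quotient.mkₐ F I
  have hπ : ∀ x y, π x = π y ↔ ∀ᶠ i in U, x i = y i := fun x y => by
    refine (Ideal.Quotient.mk_eq_mk_iff_sub_mem x y).trans ?_
    change (∀ᶠ i in U, x i - y i = 0) ↔ _
    simp only [sub_eq_zero]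
  refine ⟨N, inferInstance, inferInstance, π, hπ, fun φ => ?_⟩
  let _ : ∀ i, (Language.ring[[F]]).Structure (M i) :=
    fun i => ringConStructure (algebraMap F (M i))
  let : (Language.ring[[F]]).Structure N := ringConStructure (algebraMap F N)
  let e : (U : Filter ι).Product M ≃[Language.ring[[F]]] N :=
    { toEquiv := Equiv.ofBijective
        (Quotient.lift π fun x y h => (hπ x y).2 h)
        ⟨fun x y => by
          induction x using Quotient.inductionOn
          induction y using Quotient.inductionOn
          exact fun h => Quotient.sound ((hπ _ _).1 h),
        fun z => by
          obtain ⟨x, rfl⟩ := Ideal.Quotient.mk_surjective z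
          exact ⟨Quotient.mk _ x, rfl⟩⟩
      map_fun' := fun f x => by
        obtain ⟨y, rfl⟩ : ∃ y : Fin _ → ∀ i, M i,
            x = fun j => (y j : (U : Filter ι).Product M) :=
          ⟨fun j => (x j).out, funext fun j => (Quotient.out_eq _).symm⟩
        exact (congrArg _ (Ultraproduct.funMap_cast f y)).trans (map_funMap_pi π f y)
      map_rel' := fun r => ((relations_isEmpty F _).false r).elim }
  exact (StrongHomClass.realize_sentence e φ).symm.trans (Ultraproduct.sentence_realize φ)

theorem IsExistsN.exs {L : Language} {α : Type*} {m k : ℕ} {φ : L.BoundedFormula α k}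
    (h : IsExistsN m φ) : IsExistsN (m + k) φ.exs := by
  induction k generalizing m with
  | zero => exact h
  | succ k ih =>
    have := ih h.ex
    rwa [add_right_comm] at this

theorem exists_term_realize_eq_aeval (F : Type u) [Field F] {k : ℕ}
    (p : MvPolynomial (Fin k) F) :
    ∃ t : (Language.ring[[F]]).Term (Empty ⊕ Fin k),
      ∀ (E : Type v) [Field E] [Algebra F E] (e : Empty → E) (c : Fin k → E),
        @Term.realize _ E (ringConStructure (algebraMap F E)) _ (Sum.elim e c) t =
          MvPolynomial.aeval c p := by
  induction p using MvPolynomial.induction_on with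
  | C a =>
    refine ⟨Term.func (l := 0) (Sum.inr a) Fin.elim0, fun E _ _ e c => ?_⟩
    rw [MvPolynomial.aeval_C]
    rfl
  | add p q hp hq =>
    obtain ⟨t, ht⟩ := hp
    obtain ⟨t', ht'⟩ := hq
    refine ⟨Term.func (l := 2) (Sum.inl .add) ![t, t'], fun E _ _ e c => ?_⟩
    rw [map_add, ← ht E e, ← ht' E e]
    rfl
  | mul_X p i hp =>
    obtain ⟨t, ht⟩ := hp
    refine ⟨Term.func (l := 2) (Sum.inl .mul) ![t, Term.var (Sum.inr i)], fun E _ _ e c => ?_⟩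
    rw [map_mul, ← ht E e, MvPolynomial.aeval_X]
    rfl

/-- `c` satisfies all equations `p = 0` for `p ∈ d.1` and the inequation `d.2 ≠ 0`. -/
def IsSol {F : Type u} [Field F] {k : ℕ}
    (d : Finset (MvPolynomial (Fin k) F) × MvPolynomial (Fin k) F)
    {E : Type v} [Field E] [Algebra F E] (c : Fin k → E) : Prop :=
  (∀ p ∈ d.1, MvPolynomial.aeval c p = 0) ∧ MvPolynomial.aeval c d.2 ≠ 0

theorem exists_isQF_realize_iff_isSol (F : Type u) [Field F] {k : ℕ}
    (d : Finset (MvPolynomial (Fin k) F) × MvPolynomial (Fin k) F) :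
    ∃ φ : (Language.ring[[F]]).BoundedFormula Empty k, φ.IsQF ∧
      ∀ (E : Type v) [Field E] [Algebra F E] (e : Empty → E) (c : Fin k → E),
        @BoundedFormula.Realize _ E (ringConStructure (algebraMap F E)) _ _ φ e c ↔
          IsSol d c := by
  classical
  obtain ⟨s, q⟩ := d
  induction s using Finset.induction_on with
  | empty =>
    obtain ⟨t, ht⟩ := exists_term_realize_eq_aeval.{u, v} F q
    obtain ⟨z, hz⟩ := exists_term_realize_eq_aeval.{u, v} F (0 : MvPolynomial (Fin k) F)
    refine ⟨∼(t.bdEqual z), (BoundedFormula.IsAtomic.equal t z).isQF.not, fun E _ _ e c => ?_⟩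
    let := ringConStructure (algebraMap F E)
    rw [BoundedFormula.realize_not, BoundedFormula.realize_bdEqual, ht, hz]
    simp [IsSol]
  | insert p s _ ih =>
    obtain ⟨φ, hφ, h⟩ := ih
    obtain ⟨t, ht⟩ := exists_term_realize_eq_aeval.{u, v} F p
    obtain ⟨z, hz⟩ := exists_term_realize_eq_aeval.{u, v} F (0 : MvPolynomial (Fin k) F)
    refine ⟨t.bdEqual z ⊓ φ, (BoundedFormula.IsAtomic.equal t z).isQF.inf hφ,
      fun E _ _ e c => ?_⟩
    let := ringConStructure (algebraMap F E)
    rw [BoundedFormula.realize_inf, BoundedFormula.realize_bdEqual, ht, hz, h]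
    simp [IsSol, and_assoc]

theorem exists_isExistsN_realize_iff_exists_isSol (F : Type u) [Field F] {k : ℕ}
    (S : Finset (Finset (MvPolynomial (Fin k) F) × MvPolynomial (Fin k) F)) :
    ∃ ψ : (Language.ring[[F]]).Sentence, IsExistsN k ψ ∧
      ∀ (E : Type v) [Field E] [Algebra F E],
        RealizeRing E (algebraMap F E) ψ ↔ ∃ d ∈ S, ∃ c : Fin k → E, IsSol d c := by
  classical
  obtain ⟨φ, hφ, h⟩ : ∃ φ : (Language.ring[[F]]).BoundedFormula Empty k, φ.IsQF ∧
      ∀ (E : Type v) [Field E] [Algebra F E] (e : Empty → E) (c : Fin k → E),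
        @BoundedFormula.Realize _ E (ringConStructure (algebraMap F E)) _ _ φ e c ↔
          ∃ d ∈ S, IsSol d c := by
    induction S using Finset.induction_on with
    | empty =>
      refine ⟨⊥, .falsum, fun E _ _ e c => ?_⟩
      let := ringConStructure (algebraMap F E)
      simp
    | insert d S _ ih =>
      obtain ⟨φ, hφ, h⟩ := ih
      obtain ⟨χ, hχ, h'⟩ := exists_isQF_realize_iff_isSol.{u, v} F d
      refine ⟨χ ⊔ φ, hχ.sup hφ, fun E _ _ e c => ?_⟩
      let := ringConStructure (algebraMap F E)
      rw [BoundedFormula.realize_sup, h, h']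
      simp
  refine ⟨φ.exs, by simpa using (IsExistsN.qf (n := 0) hφ).exs, fun E _ _ => ?_⟩
  let := ringConStructure (algebraMap F E)
  refine BoundedFormula.realize_exs.trans ?_
  simp only [h]
  exact ⟨fun ⟨c, d, hd, hc⟩ => ⟨d, hd, c, hc⟩, fun ⟨d, hd, c, hc⟩ => ⟨c, d, hd, hc⟩⟩

theorem exists_fin_adjoin_eq_top {F K : Type*} [Field F] [Field K] [Algebra F K]
    [Algebra.EssFiniteType F K] {n : ℕ} (htr : Algebra.trdeg F K ≤ n)
    (h : HasSepTransBasis F K) :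
    ∃ c : Fin (n + 1) → K, IntermediateField.adjoin F (Set.range c) = ⊤ := by
  obtain ⟨t, ht, hsep⟩ := h
  have hcard : Cardinal.mk t ≤ n := ht.cardinalMk_le_trdeg.trans htr
  have : Finite t := Cardinal.lt_aleph0_iff_finite.1 (hcard.trans_lt Cardinal.natCast_lt_aleph0)
  have : Algebra.EssFiniteType (IntermediateField.adjoin F t) K :=
    Algebra.EssFiniteType.of_comp F _ K
  have : FiniteDimensional (IntermediateField.adjoin F t) K :=
    Algebra.finite_of_essFiniteType_of_isAlgebraic
  obtain ⟨a, ha⟩ := Field.exists_primitive_element (IntermediateField.adjoin F t) K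
  have hta : IntermediateField.adjoin F (t ∪ {a}) = ⊤ := by
    rw [← IntermediateField.adjoin_adjoin_left, ha, IntermediateField.restrictScalars_top]
  obtain ⟨b, hb⟩ : ∃ b : Fin n → K, t ⊆ Set.range b := by
    obtain ⟨f⟩ : Nonempty (t ↪ Fin n) := Cardinal.lift_mk_le'.1 (by simpa using hcard)
    exact ⟨Function.extend f (↑) 0, fun x hx => ⟨f ⟨x, hx⟩, f.injective.extend_apply _ _ _⟩⟩
  refine ⟨Fin.cons a b, top_unique (hta.symm.le.trans (IntermediateField.adjoin.mono _ _ _ ?_))⟩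
  rw [Fin.range_cons]
  rintro x (hx | hx)
  · exact Or.inr (hb hx)
  · exact Or.inl hx

theorem exists_subalgebra_algHom {F : Type u} {E : Type v} {M : Type w} [Field F] [Field E]
    [Field M] [Algebra F E] [Algebra F M] {k : ℕ} {c : Fin k → E} {c' : Fin k → M}
    {q : MvPolynomial (Fin k) F} (hq : MvPolynomial.aeval c q ≠ 0)
    (hq' : MvPolynomial.aeval c' q ≠ 0)
    (h : ∀ p : MvPolynomial (Fin k) F, MvPolynomial.aeval c p = 0 → MvPolynomial.aeval c' p = 0) :
    ∃ A : Subalgebra F E,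
      (∀ x, (∃ p : MvPolynomial (Fin k) F,
        x * MvPolynomial.aeval c q = MvPolynomial.aeval c p) → x ∈ A) ∧ Nonempty (A →ₐ[F] M) := by
  let R := Localization.Away q
  let e : R →ₐ[F] E := IsLocalization.Away.liftAlgHom q (f := MvPolynomial.aeval c) hq.isUnit
  let e' : R →ₐ[F] M := IsLocalization.Away.liftAlgHom q (f := MvPolynomial.aeval c') hq'.isUnit
  have he (p) : e (algebraMap _ R p) = MvPolynomial.aeval c p :=
    IsLocalization.Away.lift_eq q hq.isUnit p
  have he' (p) : e' (algebraMap _ R p) = MvPolynomial.aeval c' p :=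
    IsLocalization.Away.lift_eq q hq'.isUnit p
  have hu : IsUnit (algebraMap _ R q) := IsLocalization.Away.algebraMap_isUnit q
  have hker : RingHom.ker e ≤ RingHom.ker e' := fun r hr => by
    obtain ⟨m, p, hp⟩ := IsLocalization.Away.surj q r
    rw [RingHom.mem_ker] at hr ⊢
    have h₁ : e' r * e' (algebraMap _ R q) ^ m = 0 := by
      rw [← map_pow, ← map_mul, hp, he']
      exact h p (by rw [← he, ← hp, map_mul, hr, zero_mul])
    exact (mul_eq_zero.1 h₁).resolve_right (pow_ne_zero _ (by rwa [he']))
  refine ⟨e.range, ?_, ⟨(Ideal.Quotient.liftₐ (RingHom.ker e) e' hker).comp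
    (Ideal.quotientKerEquivRange e).symm.toAlgHom⟩⟩
  rintro x ⟨p, hp⟩
  obtain ⟨u, hu⟩ := hu
  refine ⟨algebraMap _ R p * ↑u⁻¹, ?_⟩
  refine mul_right_cancel₀ hq ?_
  change e _ * _ = _
  rw [hp, ← he q, ← he p, ← map_mul, ← hu, mul_assoc, Units.inv_mul, mul_one]

theorem exists_common_denominator {F : Type u} {K : Type v} [Field F] [Field K] [Algebra F K]
    {k : ℕ} {c : Fin k → K} (hc : IntermediateField.adjoin F (Set.range c) = ⊤) (s : Finset K) :
    ∃ q : MvPolynomial (Fin k) F, MvPolynomial.aeval c q ≠ 0 ∧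
      ∀ x ∈ s, ∃ p : MvPolynomial (Fin k) F,
        x * MvPolynomial.aeval c q = MvPolynomial.aeval c p := by
  classical
  induction s using Finset.induction_on with
  | empty => exact ⟨1, by simp, by simp⟩
  | insert a s _ ih =>
    obtain ⟨q, hq, h⟩ := ih
    obtain ⟨r, t, ha⟩ := (IntermediateField.mem_adjoin_range_iff F c a).1 (hc ▸ trivial)
    by_cases ht : MvPolynomial.aeval c t = 0
    · refine ⟨q, hq, (Finset.forall_mem_insert _ _ _).2 ⟨⟨0, by simp [ha, ht]⟩, h⟩⟩
    · refine ⟨q * t, by simp [hq, ht], (Finset.forall_mem_insert _ _ _).2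
        ⟨⟨q * r, ?_⟩, fun x hx => ?_⟩⟩
      · rw [ha, map_mul, map_mul]
        field_simp
      · obtain ⟨p, hp⟩ := h x hx
        exact ⟨p * t, by rw [map_mul, map_mul, ← mul_assoc, hp]⟩

/-- `E` is a model of the `L_ring(F)`-theory `T`. -/
def IsModel {F : Type u} [Field F] (T : Set ((Language.ring[[F]]).Sentence))
    (E : Type v) [Field E] [Algebra F E] : Prop :=
  ∀ ψ ∈ T, RealizeRing E (algebraMap F E) ψ

theorem exists_isModel_forall_not_isSol {F : Type u} [Field F]
    {T : Set ((Language.ring[[F]]).Sentence)} {k : ℕ}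
    (Γ : Set (Finset (MvPolynomial (Fin k) F) × MvPolynomial (Fin k) F))
    (h : ∀ Δ : Finset (Finset (MvPolynomial (Fin k) F) × MvPolynomial (Fin k) F), ↑Δ ⊆ Γ →
      ∃ (E : Type v) (_ : Field E) (_ : Algebra F E), IsModel T E ∧
        ∀ d ∈ Δ, ∀ c : Fin k → E, ¬ IsSol d c) :
    ∃ (E : Type v) (_ : Field E) (_ : Algebra F E), IsModel T E ∧
      ∀ d ∈ Γ, ∀ c : Fin k → E, ¬ IsSol d c := by
  classical
  obtain ⟨E, _, _, -, -⟩ := h ∅ (by simp)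
  have : Small.{v} (MvPolynomial (Fin k) F) :=
    small_of_injective (MvPolynomial.map_injective (algebraMap F E) (algebraMap F E).injective)
  have : Small.{v} (Finset (MvPolynomial (Fin k) F)) :=
    small_of_injective (Finset.map_injective (equivShrink.{v} (MvPolynomial (Fin k) F)).toEmbedding)
  let e := equivShrink.{v} Γ
  have hΔ (s : Finset (Shrink.{v} Γ)) :
      ((s.image fun x => (e.symm x).1 : Finset _) : Set _) ⊆ Γ := by
    intro d hd
    obtain ⟨x, -, rfl⟩ := Finset.mem_image.1 hd
    exact (e.symm x).2
  choose M hM₁ hM₂ hM hsol using fun s => h _ (hΔ s)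
  let U : Ultrafilter (Finset (Shrink.{v} Γ)) := Ultrafilter.of Filter.atTop
  have hU : (U : Filter (Finset (Shrink.{v} Γ))) ≤ Filter.atTop := Ultrafilter.of_le _
  obtain ⟨N, _, _, π, -, hN⟩ := exists_ultraproduct (F := F) U M
  refine ⟨N, inferInstance, inferInstance,
    fun ψ hψ => (hN ψ).2 (Filter.Eventually.of_forall fun s => hM s ψ hψ), fun d hd c hc => ?_⟩
  obtain ⟨ψ, -, hψ⟩ := exists_isExistsN_realize_iff_exists_isSol.{u, v} F {d}
  have h₁ := (hN ψ).1 ((hψ N).2 ⟨d, by simp, c, hc⟩)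
  obtain ⟨s, hs, hs'⟩ := (h₁.and (hU (Filter.eventually_ge_atTop {e ⟨d, hd⟩}))).exists
  obtain ⟨d', hd', c', hc'⟩ := (hψ _).1 hs
  obtain rfl := Finset.mem_singleton.1 hd'
  exact hsol s d' (Finset.mem_image.2 ⟨_, hs' (Finset.mem_singleton_self _), by simp⟩) c' hc'

theorem exists_isModel_nonempty_algHom {F : Type u} [Field F]
    {T : Set ((Language.ring[[F]]).Sentence)} {K : Type v} [Field K] [Algebra F K]
    (h : ∀ s : Finset K, ∃ (M : Type v) (_ : Field M) (_ : Algebra F M), IsModel T M ∧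
      ∃ A : Subalgebra F K, (s : Set K) ⊆ A ∧ Nonempty (A →ₐ[F] M)) :
    ∃ (M : Type v) (_ : Field M) (_ : Algebra F M), IsModel T M ∧ Nonempty (K →ₐ[F] M) := by
  classical
  choose M hM₁ hM₂ hM A hA f using h
  replace f s := (f s).some
  let U : Ultrafilter (Finset K) := Ultrafilter.of Filter.atTop
  have hle : (U : Filter (Finset K)) ≤ Filter.atTop := Ultrafilter.of_le _
  have hU (x : K) : ∀ᶠ s in U, x ∈ A s := by
    filter_upwards [hle (Filter.eventually_ge_atTop {x})] with s hs
    exact hA s (hs (Finset.mem_singleton_self x))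
  obtain ⟨N, _, _, π, hπ, hN⟩ := exists_ultraproduct (F := F) U M
  refine ⟨N, inferInstance, inferInstance,
    fun ψ hψ => (hN ψ).2 (Filter.Eventually.of_forall fun s => hM s ψ hψ), ⟨?_⟩⟩
  let g (x : K) (s : Finset K) : M s := if hx : x ∈ A s then f s ⟨x, hx⟩ else 0
  exact
    { toFun x := π (g x)
      map_one' := by
        rw [← map_one π, hπ]
        filter_upwards [] with s
        exact (dif_pos (one_mem (A s))).trans (map_one (f s))
      map_mul' x y := by
        rw [← map_mul π, hπ]
        filter_upwards [hU x, hU y] with s hx hy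
        simp only [g, Pi.mul_apply, dif_pos hx, dif_pos hy, dif_pos (mul_mem hx hy)]
        exact map_mul (f s) ⟨x, hx⟩ ⟨y, hy⟩
      map_zero' := by
        rw [← map_zero π, hπ]
        filter_upwards [] with s
        exact (dif_pos (zero_mem (A s))).trans (map_zero (f s))
      map_add' x y := by
        rw [← map_add π, hπ]
        filter_upwards [hU x, hU y] with s hx hy
        simp only [g, Pi.add_apply, dif_pos hx, dif_pos hy, dif_pos (add_mem hx hy)]
        exact map_add (f s) ⟨x, hx⟩ ⟨y, hy⟩
      commutes' r := by
        rw [← π.commutes r, hπ]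
        filter_upwards [] with s
        exact (dif_pos ((A s).algebraMap_mem r)).trans ((f s).commutes r) }

/-- A subextension `K/F` of transcendence degree at most `n` of a separable extension is locally
described by systems of equations and one inequation in `n + 1` variables. -/
theorem exists_isSol_forall_exists_subalgebra_algHom {F : Type u} {E : Type v} [Field F] [Field E]
    [Algebra F E] (hE : IsSepExt F E) {K : IntermediateField F E} {n : ℕ} (hK : TrdegLE F K n)
    (s : Finset K) :
    ∃ (d : Finset (MvPolynomial (Fin (n + 1)) F) × MvPolynomial (Fin (n + 1)) F)
      (c : Fin (n + 1) → E), IsSol d c ∧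
      ∀ (M : Type v) [Field M] [Algebra F M] (c' : Fin (n + 1) → M), IsSol d c' →
        ∃ A : Subalgebra F K, (s : Set K) ⊆ A ∧ Nonempty (A →ₐ[F] M) := by
  classical
  let s' : Finset E := s.image (↑)
  let L : IntermediateField F E := IntermediateField.adjoin F (s' : Set E)
  have hLK : L ≤ K := IntermediateField.adjoin_le_iff.2 (by simp +contextual [s', Set.subset_def])
  have hsL (x : K) (hx : x ∈ s) : (x : E) ∈ L :=
    IntermediateField.subset_adjoin F _ (Finset.mem_coe.2 (Finset.mem_image_of_mem _ hx))
  have : Algebra.EssFiniteType F L :=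
    IntermediateField.essFiniteType_iff.2 (IntermediateField.fg_adjoin_finset s')
  have htr : Algebra.trdeg F L ≤ n := by
    obtain ⟨t, htn, ht⟩ := hK
    refine (trdeg_le_of_injective (IntermediateField.inclusion hLK)
      (IntermediateField.inclusion_injective hLK)).trans ?_
    rw [← ht.cardinalMk_eq_trdeg]
    simpa using htn
  obtain ⟨c, hc⟩ := exists_fin_adjoin_eq_top htr (hE s')
  obtain ⟨q, hq, hs⟩ := exists_common_denominator hc 
    (s.attach.image fun x : s => (⟨x.1.1, hsL x.1 x.2⟩ : L))
  obtain ⟨G, hG⟩ := (inferInstance : IsNoetherianRing (MvPolynomial (Fin (n + 1)) F)).noetherian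
    (RingHom.ker (MvPolynomial.aeval (R := F) c))
  have hmap {B : Type v} [Field B] [Algebra F B] (f : L →ₐ[F] B)
      (p : MvPolynomial (Fin (n + 1)) F) :
      MvPolynomial.aeval (fun i => f (c i)) p = f (MvPolynomial.aeval c p) :=
    (MvPolynomial.comp_aeval_apply c f p).symm
  refine ⟨(G, q), fun i => L.val (c i), ⟨fun p hp => ?_, ?_⟩, fun M _ _ c' hc' => ?_⟩
  · have : p ∈ RingHom.ker (MvPolynomial.aeval (R := F) c) := hG ▸ Submodule.subset_span hp
    rw [hmap, (RingHom.mem_ker).1 this, map_zero]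
  · rw [hmap]
    exact (map_ne_zero _).2 hq
  · let ι : L →ₐ[F] K := IntermediateField.inclusion hLK
    have hker : RingHom.ker (MvPolynomial.aeval (R := F) c) ≤
        RingHom.ker (MvPolynomial.aeval (R := F) c') := by
      rw [← hG]
      exact Submodule.span_le.2 fun p hp => hc'.1 p hp
    obtain ⟨A, hA, hf⟩ := exists_subalgebra_algHom (c := fun i => ι (c i)) (c' := c') (q := q)
      (by rw [hmap]; exact (map_ne_zero _).2 hq) hc'.2 fun p hp => by
        rw [hmap, map_eq_zero] at hp
        exact hker hp
    refine ⟨A, fun x hx => hA x ?_, hf⟩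
    obtain ⟨p, hp⟩ := hs ⟨x, hsL x hx⟩ (Finset.mem_image.2 
      ⟨⟨x, Finset.mem_coe.1 hx⟩, Finset.mem_attach s _, rfl⟩)
    refine ⟨p, ?_⟩
    rw [hmap, hmap, ← hp, map_mul]
    rfl

/-- Lemma `lem:efd_sep` of the paper.
Let `F` be a field and `T` an `L_ring(F)`-theory all of whose models are separable field
extensions of `F`.  Then every existential `L_ring(F)`-sentence `φ` with `efd_T(φ) ≤ n` is
equivalent modulo `T` to an `∃_{n+1}`-`L_ring(F)`-sentence. -/
theorem statement12 (F : Type u) [Field F] (T : Set ((Language.ring[[F]]).Sentence))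
    -- every (field-extension) model of `T` is a separable extension of `F`
    (hT : ∀ (E : Type v) [Field E] [Algebra F E],
      (∀ ψ ∈ T, RealizeRing E (algebraMap F E) ψ) → IsSepExt F E)
    (n : ℕ) (φ : (Language.ring[[F]]).Sentence) (hφ : IsExists φ)
    (hefd : EfdLE.{u, v, v} F T φ n) :
    ∃ ψ : (Language.ring[[F]]).Sentence, IsExistsN (n + 1) ψ ∧
      ∀ (E : Type v) [Field E] [Algebra F E],
        (∀ χ ∈ T, RealizeRing E (algebraMap F E) χ) →
        (RealizeRing E (algebraMap F E) φ ↔ RealizeRing E (algebraMap F E) ψ) := by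
  classical
  by_contra! hno
  let Γ : Set (Finset (MvPolynomial (Fin (n + 1)) F) × MvPolynomial (Fin (n + 1)) F) :=
    {d | ∀ (E : Type v) [Field E] [Algebra F E], IsModel T E →
      ∀ c : Fin (n + 1) → E, IsSol d c → RealizeRing E (algebraMap F E) φ}
  obtain ⟨E, _, _, hE, hΓ⟩ := exists_isModel_forall_not_isSol.{u, v} (T := insert φ T) Γ
    fun Δ hΔ => by
      obtain ⟨ψ, hψ, h⟩ := exists_isExistsN_realize_iff_exists_isSol.{u, v} F Δ
      obtain ⟨E, _, _, hE, ⟨h₁, h₂⟩ | ⟨h₁, h₂⟩⟩ := hno ψ hψ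
      · refine ⟨E, inferInstance, inferInstance, Set.forall_mem_insert.2 ⟨h₁, hE⟩,
          fun d hd c hc => h₂ ((h E).2 ⟨d, hd, c, hc⟩)⟩
      · obtain ⟨d, hd, c, hc⟩ := (h E).1 h₂
        exact (h₁ (hΔ hd E hE c hc)).elim
  obtain ⟨hEφ, hET⟩ := Set.forall_mem_insert.1 hE
  obtain ⟨E₀, hE₀, hM⟩ := hefd E hET hEφ
  have hnot (M : Type v) [Field M] [Algebra F M] :
      RealizeRing M (algebraMap F M) φ.not ↔ ¬ RealizeRing M (algebraMap F M) φ := by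
    let := ringConStructure (algebraMap F M)
    exact Sentence.realize_not M
  obtain ⟨M, _, _, hMT, hE₀M⟩ := exists_isModel_nonempty_algHom (T := insert φ.not T)
    (K := E₀) fun s => by
      obtain ⟨d, c, hc, h⟩ := exists_isSol_forall_exists_subalgebra_algHom (hT E hET) hE₀ s
      have hd : d ∉ Γ := fun hd => hΓ d hd c hc
      simp only [Γ, Set.mem_ofPred_eq] at hd
      push Not at hd
      obtain ⟨M, _, _, hM, c', hc', hφM⟩ := hd
      exact ⟨M, inferInstance, inferInstance,
        Set.forall_mem_insert.2 ⟨(hnot M).2 hφM, hM⟩, h M c' hc'⟩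
  obtain ⟨hMφ, hMT⟩ := Set.forall_mem_insert.1 hMT
  exact (hnot M).1 hMφ (hM M hMT hE₀M)

end Paper
end

section
/- Let K and L be two separable field extensions of a field C and n ∈ ℕ. Then Th_{∃_n∃_1}(K,C) ⊆ Th_{∃_n∃_1}(L,C) if and only if Th_{∃_{n+1}}(K,C) ⊆ Th_{∃_{n+1}}(L,C). -/
open FirstOrder FirstOrder.Language

universe u v w x

namespace Paper

/-- The value of an `L_ring(α)`-term at `v`, with constants interpreted via `f`. -/
noncomputable def termVal {α M : Type*} [CommRing M] (f : α → M) {k : ℕ}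
    (τ : (Language.ring[[α]]).Term (Empty ⊕ Fin k)) (v : Fin k → M) : M :=
  @Term.realize _ M (ringConStructure f) _ (Sum.elim default v) τ

/-- `M ⊨ φ(v)` for an `L_ring(α)`-formula, with constants interpreted via `f`. -/
def Holds {α M : Type*} [CommRing M] (f : α → M) {k : ℕ}
    (φ : (Language.ring[[α]]).BoundedFormula Empty k) (v : Fin k → M) : Prop :=
  @BoundedFormula.Realize _ M (ringConStructure f) _ _ φ default v

section Holds

variable {α M : Type*} [CommRing M] (f : α → M) {k : ℕ}

theorem holds_imp {φ ψ : (Language.ring[[α]]).BoundedFormula Empty k} (v : Fin k → M) :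
    Holds f (φ.imp ψ) v ↔ (Holds f φ v → Holds f ψ v) := Iff.rfl

theorem holds_equal (τ σ : (Language.ring[[α]]).Term (Empty ⊕ Fin k)) (v : Fin k → M) :
    Holds f (τ.bdEqual σ) v ↔ termVal f τ v = termVal f σ v := Iff.rfl

theorem holds_inf {φ ψ : (Language.ring[[α]]).BoundedFormula Empty k} (v : Fin k → M) :
    Holds f (φ ⊓ ψ) v ↔ Holds f φ v ∧ Holds f ψ v :=
  letI := ringConStructure f
  BoundedFormula.realize_inf

theorem holds_sup {φ ψ : (Language.ring[[α]]).BoundedFormula Empty k} (v : Fin k → M) :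
    Holds f (φ ⊔ ψ) v ↔ Holds f φ v ∨ Holds f ψ v :=
  letI := ringConStructure f
  BoundedFormula.realize_sup

theorem holds_ex {φ : (Language.ring[[α]]).BoundedFormula Empty (k + 1)} (v : Fin k → M) :
    Holds f φ.ex v ↔ ∃ x, Holds f φ (Fin.snoc v x) :=
  letI := ringConStructure f
  BoundedFormula.realize_ex

theorem holds_exs {φ : (Language.ring[[α]]).BoundedFormula Empty k} :
    RealizeRing M f φ.exs ↔ ∃ v, Holds f φ v :=
  letI := ringConStructure f
  BoundedFormula.realize_exs

end Holds

/-- Every term is given by a polynomial, uniformly in all `C`-algebras. -/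
theorem exists_mvPolynomial_termVal {C : Type*} [CommRing C] {k : ℕ}
    (τ : (Language.ring[[C]]).Term (Empty ⊕ Fin k)) :
    ∃ p : MvPolynomial (Fin k) C, ∀ (M : Type u) [CommRing M] [Algebra C M] (v : Fin k → M),
      termVal (algebraMap C M) τ v = MvPolynomial.aeval v p := by
  induction τ with
  | var i =>
    rcases i with i | i
    · exact i.elim
    · exact ⟨MvPolynomial.X i, fun M _ _ v => by simp [termVal]⟩
  | @func l F ts ih =>
    choose p hp using ih
    rcases F with F | F
    · cases F with
      | add =>
        refine ⟨p 0 + p 1, fun M _ _ v => ?_⟩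
        rw [map_add, ← hp, ← hp]; rfl
      | mul =>
        refine ⟨p 0 * p 1, fun M _ _ v => ?_⟩
        rw [map_mul, ← hp, ← hp]; rfl
      | neg =>
        refine ⟨- p 0, fun M _ _ v => ?_⟩
        rw [map_neg, ← hp]; rfl
      | zero => exact ⟨0, fun M _ _ v => by rw [map_zero]; rfl⟩
      | one => exact ⟨1, fun M _ _ v => by rw [map_one]; rfl⟩
    · match l, F with
      | 0, c => exact ⟨MvPolynomial.C (show C from c), fun M _ _ v => (MvPolynomial.aeval_C _ _).symm⟩

/-- Every polynomial is given by a term, uniformly in all `C`-algebras. -/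
theorem exists_term_termVal {C : Type*} [CommRing C] {k : ℕ} (p : MvPolynomial (Fin k) C) :
    ∃ τ : (Language.ring[[C]]).Term (Empty ⊕ Fin k),
      ∀ (M : Type u) [CommRing M] [Algebra C M] (v : Fin k → M),
      termVal (algebraMap C M) τ v = MvPolynomial.aeval v p := by
  induction p using MvPolynomial.induction_on with
  | C c =>
    exact ⟨Term.func (Sum.inr (show (constantsOn C).Functions 0 from c)) ![],
      fun M _ _ v => by rw [MvPolynomial.aeval_C]; rfl⟩
  | add p q hp hq =>
    obtain ⟨τ, hτ⟩ := hp
    obtain ⟨σ, hσ⟩ := hq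
    refine ⟨Term.func (Sum.inl (Ring.addFunc)) ![τ, σ], fun M _ _ v => ?_⟩
    rw [map_add, ← hτ, ← hσ]; rfl
  | mul_X p i hp =>
    obtain ⟨τ, hτ⟩ := hp
    refine ⟨Term.func (Sum.inl (Ring.mulFunc)) ![τ, Term.var (Sum.inr i)], fun M _ _ v => ?_⟩
    rw [map_mul, ← hτ, MvPolynomial.aeval_X]; rfl

theorem elim_ring_relations {α : Type*} {l : ℕ} (R : (Language.ring[[α]]).Relations l) : False := by
  rcases R with R | R
  · exact isEmptyElim R
  · exact Empty.elim R

/-- The truth of a quantifier-free formula is preserved by a partial homomorphism `g ∘ ι⁻¹` that is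
defined on a suitable finite set of elements. -/
theorem exists_finset_holds_iff_of_isQF {C M : Type u} [CommRing C] [Field M] [Algebra C M] {k : ℕ}
    {φ : (Language.ring[[C]]).BoundedFormula Empty k} (hφ : φ.IsQF) (v : Fin k → M) :
    ∃ S : Set M, S.Finite ∧ ∀ (R N : Type u) [CommRing R] [Algebra C R] [CommRing N] [Algebra C N]
      [Nontrivial N] (ι : R →ₐ[C] M) (g : R →ₐ[C] N), (∀ x, ι x = 0 → g x = 0) → S ⊆ Set.range ι →
      ∀ w : Fin k → R, (∀ i, ι (w i) = v i) →
        (Holds (algebraMap C M) φ v ↔ Holds (algebraMap C N) φ (fun i => g (w i))) := by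
  induction hφ with
  | falsum => exact ⟨∅, Set.finite_empty, fun R N _ _ _ _ _ ι g _ _ w _ => Iff.rfl⟩
  | of_isAtomic h =>
    cases h with
    | equal τ σ =>
      obtain ⟨p, hp⟩ := exists_mvPolynomial_termVal.{u} τ
      obtain ⟨q, hq⟩ := exists_mvPolynomial_termVal.{u} σ
      refine ⟨{(MvPolynomial.aeval v (p - q))⁻¹}, Set.finite_singleton _,
        fun R N _ _ _ _ _ ι g hker hS w hw => ?_⟩
      obtain rfl : (fun i => ι (w i)) = v := funext hw
      rw [holds_equal, holds_equal, hp, hp, hq, hq, ← sub_eq_zero, ← map_sub,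
        ← sub_eq_zero (b := MvPolynomial.aeval (fun i => g (w i)) q), ← map_sub]
      obtain ⟨z, hz⟩ := hS rfl
      have h1 : MvPolynomial.aeval (fun i => ι (w i)) (p - q)
          = ι (MvPolynomial.aeval w (p - q)) := by
        rw [← AlgHom.comp_apply, MvPolynomial.comp_aeval]
      have h2 : MvPolynomial.aeval (fun i => g (w i)) (p - q)
          = g (MvPolynomial.aeval w (p - q)) := by
        rw [← AlgHom.comp_apply, MvPolynomial.comp_aeval]
      rw [h1] at hz ⊢
      rw [h2]
      refine ⟨hker _, fun h0 => ?_⟩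
      by_contra hne
      have h3 := hker (MvPolynomial.aeval w (p - q) * z - 1) (by
        rw [map_sub, map_mul, hz, mul_inv_cancel₀ hne, map_one, sub_self])
      rw [map_sub, map_mul, h0, zero_mul, map_one, zero_sub, neg_eq_zero] at h3
      exact one_ne_zero h3
    | rel R ts => exact (elim_ring_relations R).elim
  | imp _ _ ih₁ ih₂ =>
    obtain ⟨S₁, f₁, h₁⟩ := ih₁
    obtain ⟨S₂, f₂, h₂⟩ := ih₂
    refine ⟨S₁ ∪ S₂, f₁.union f₂, fun R N _ _ _ _ _ ι g hker hS w hw => ?_⟩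
    rw [holds_imp, holds_imp,
      h₁ R N ι g hker (Set.subset_union_left.trans hS) w hw,
      h₂ R N ι g hker (Set.subset_union_right.trans hS) w hw]

/-- `φ` holds at the image of `v` under every partial homomorphism `g ∘ ι⁻¹` defined on `S`. -/
def Transfers {C M : Type u} [CommRing C] [Field M] [Algebra C M] {k : ℕ}
    (φ : (Language.ring[[C]]).BoundedFormula Empty k) (v : Fin k → M) (S : Set M) : Prop :=
  ∀ (R N : Type u) [CommRing R] [Algebra C R] [CommRing N] [Algebra C N]
      [Nontrivial N] (ι : R →ₐ[C] M) (g : R →ₐ[C] N), (∀ x, ι x = 0 → g x = 0) → S ⊆ Set.range ι →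
      ∀ w : Fin k → R, (∀ i, ι (w i) = v i) → Holds (algebraMap C N) φ (fun i => g (w i))

theorem exists_transfers_of_isQF {C M : Type u} [CommRing C] [Field M] [Algebra C M] {k : ℕ}
    {φ : (Language.ring[[C]]).BoundedFormula Empty k} (hφ : φ.IsQF) {v : Fin k → M}
    (h : Holds (algebraMap C M) φ v) : ∃ S : Set M, S.Finite ∧ Transfers φ v S := by
  obtain ⟨S, hS, H⟩ := exists_finset_holds_iff_of_isQF hφ v
  exact ⟨S, hS, fun R N _ _ _ _ _ ι g hker hS w hw => (H R N ι g hker hS w hw).1 h⟩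

theorem exists_transfers_ex {C M : Type u} [CommRing C] [Field M] [Algebra C M] {k : ℕ}
    {φ : (Language.ring[[C]]).BoundedFormula Empty (k + 1)}
    (hφ : ∀ v : Fin (k + 1) → M, Holds (algebraMap C M) φ v →
      ∃ S : Set M, S.Finite ∧ Transfers φ v S) {v : Fin k → M}
    (h : Holds (algebraMap C M) φ.ex v) : ∃ S : Set M, S.Finite ∧ Transfers φ.ex v S := by
  obtain ⟨x, hx⟩ := (holds_ex _ _).1 h
  obtain ⟨S, fS, hS⟩ := hφ _ hx
  refine ⟨insert x S, fS.insert x, fun R N _ _ _ _ _ ι g hker hS' w hw => ?_⟩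
  obtain ⟨z, hz⟩ := hS' (Set.mem_insert x S)
  refine (holds_ex _ _).2 ⟨g z, ?_⟩
  convert hS R N ι g hker ((Set.subset_insert x S).trans hS') (Fin.snoc w z) ?_ using 1
  · funext i
    refine Fin.lastCases ?_ (fun i => ?_) i <;> simp
  · intro i
    refine Fin.lastCases ?_ (fun i => ?_) i <;> simp [hz, hw]

theorem exists_transfers_of_isE1 {C M : Type u} [CommRing C] [Field M] [Algebra C M] {k : ℕ}
    {φ : (Language.ring[[C]]).BoundedFormula Empty k} (hφ : IsE1 φ) {v : Fin k → M}
    (h : Holds (algebraMap C M) φ v) : ∃ S : Set M, S.Finite ∧ Transfers φ v S := by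
  unfold IsE1 at hφ
  induction hφ with
  | base h' =>
    rcases h' with h' | ⟨ψ, h', rfl⟩
    · exact exists_transfers_of_isQF h' h
    · exact exists_transfers_ex (fun v hv => exists_transfers_of_isQF h' hv) h
  | inf _ _ ih₁ ih₂ =>
    obtain ⟨h₁, h₂⟩ := (holds_inf _ _).1 h
    obtain ⟨S₁, f₁, H₁⟩ := ih₁ h₁
    obtain ⟨S₂, f₂, H₂⟩ := ih₂ h₂
    exact ⟨S₁ ∪ S₂, f₁.union f₂, fun R N _ _ _ _ _ ι g hker hS w hw => (holds_inf _ _).2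
      ⟨H₁ R N ι g hker (Set.subset_union_left.trans hS) w hw,
        H₂ R N ι g hker (Set.subset_union_right.trans hS) w hw⟩⟩
  | sup _ _ ih₁ ih₂ =>
    rcases (holds_sup _ _).1 h with h | h
    · obtain ⟨S, f, H⟩ := ih₁ h
      exact ⟨S, f, fun R N _ _ _ _ _ ι g hker hS w hw =>
        (holds_sup _ _).2 (Or.inl (H R N ι g hker hS w hw))⟩
    · obtain ⟨S, f, H⟩ := ih₂ h
      exact ⟨S, f, fun R N _ _ _ _ _ ι g hker hS w hw =>
        (holds_sup _ _).2 (Or.inr (H R N ι g hker hS w hw))⟩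

theorem exists_transfers_of_isExistsNE1 {C M : Type u} [CommRing C] [Field M] [Algebra C M]
    {n k : ℕ} {φ : (Language.ring[[C]]).BoundedFormula Empty k} (hφ : IsExistsNE1 n φ)
    {v : Fin k → M} (h : Holds (algebraMap C M) φ v) :
    ∃ S : Set M, S.Finite ∧ Transfers φ v S := by
  induction hφ with
  | e1 hφ => exact exists_transfers_of_isE1 hφ h
  | ex _ ih => exact exists_transfers_ex (fun v hv => ih hv) h

theorem isExistsN_exs {L : Language} {α : Type*} {k : ℕ} : ∀ {m n : ℕ} {φ : L.BoundedFormula α k},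
    IsExistsN m φ → m + k = n → IsExistsN n φ.exs := by
  induction k with
  | zero => rintro m n φ h rfl; exact h
  | succ k ih => intro m n φ h hn; exact ih h.ex (by omega)

theorem exists_isQF_holds_iff {C : Type u} [CommRing C] {k : ℕ}
    (P : Finset (MvPolynomial (Fin k) C)) (d : MvPolynomial (Fin k) C) :
    ∃ φ : (Language.ring[[C]]).BoundedFormula Empty k, φ.IsQF ∧
      ∀ (M : Type u) [CommRing M] [Algebra C M] (v : Fin k → M),
        Holds (algebraMap C M) φ v ↔
          (∀ p ∈ P, MvPolynomial.aeval v p = 0) ∧ MvPolynomial.aeval v d ≠ 0 := by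
  classical
  obtain ⟨ζ, hζ⟩ := exists_term_termVal.{u} (0 : MvPolynomial (Fin k) C)
  induction P using Finset.induction_on with
  | empty =>
    obtain ⟨τ, hτ⟩ := exists_term_termVal.{u} d
    refine ⟨(τ.bdEqual ζ).not, (BoundedFormula.IsAtomic.equal _ _).isQF.not, fun M _ _ v => ?_⟩
    have : Holds (algebraMap C M) (τ.bdEqual ζ).not v ↔ ¬ Holds (algebraMap C M) (τ.bdEqual ζ) v :=
      Iff.rfl
    rw [this, holds_equal, hτ, hζ]
    simp
  | insert p P _ ih =>
    obtain ⟨φ, hφ, H⟩ := ih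
    obtain ⟨τ, hτ⟩ := exists_term_termVal.{u} p
    refine ⟨τ.bdEqual ζ ⊓ φ, (BoundedFormula.IsAtomic.equal _ _).isQF.inf hφ, fun M _ _ v => ?_⟩
    rw [holds_inf, holds_equal, H, hτ, hζ]
    simp [and_assoc]

theorem IsPosBC.mono {L : Language} {α : Type*}
    {P Q : ∀ {k : ℕ}, L.BoundedFormula α k → Prop}
    (h : ∀ {k : ℕ} (φ : L.BoundedFormula α k), P φ → Q φ) {k : ℕ} {φ : L.BoundedFormula α k}
    (hφ : IsPosBC P φ) : IsPosBC Q φ := by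
  induction hφ with
  | base h' => exact .base (h _ h')
  | inf _ _ ih₁ ih₂ => exact .inf ih₁ ih₂
  | sup _ _ ih₁ ih₂ => exact .sup ih₁ ih₂

theorem IsExistsN.isExistsNE1 {L : Language} {α : Type*} {n k : ℕ} {φ : L.BoundedFormula α k}
    (h : IsExistsN (n + 1) φ) : IsExistsNE1 n φ := by
  induction n generalizing k with
  | zero =>
    cases h with
    | qf h => exact .e1 (.base (.inl h))
    | ex h =>
      cases h with
      | qf h => exact .e1 (.base (.inr ⟨_, h, rfl⟩))
  | succ n ih =>
    cases h with
    | qf h => exact .e1 (.base (.inl h))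
    | ex h => exact .ex (ih h)

end Paper

namespace Paper

open IntermediateField

/-- If `F` is generated by `m` elements, then the `∃_m`-theory suffices to map a
finitely generated part of `F` to `L`. -/
theorem exists_algHom_of_thRingSub {C K L F : Type u} [Field C] [Field K] [Algebra C K]
    [Field L] [Algebra C L] [Field F] [Algebra C F] {m : ℕ}
    (H : ThRingSub (fun {_} φ => IsExistsN m φ) K (algebraMap C K) L (algebraMap C L))
    (j : F →ₐ[C] K) (t : Fin m → F) (ht : adjoin C (Set.range t) = ⊤)
    (S : Set F) (hS : S.Finite) :
    ∃ (R : Type u) (_ : CommRing R) (_ : Algebra C R) (ι : R →ₐ[C] F) (g : R →ₐ[C] L),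
      (∀ x, ι x = 0 → g x = 0) ∧ S ⊆ Set.range ι := by
  have key : ∀ s : F, ∃ P Q : MvPolynomial (Fin m) C, MvPolynomial.aeval t Q ≠ 0 ∧
      s * MvPolynomial.aeval t Q = MvPolynomial.aeval t P := by
    intro s
    obtain ⟨P, Q, h⟩ := (mem_adjoin_range_iff C t s).1 (ht ▸ mem_top)
    by_cases hQ : MvPolynomial.aeval t Q = 0
    · refine ⟨0, 1, by simp, ?_⟩
      rw [h, hQ]; simp
    · exact ⟨P, Q, hQ, by rw [h, div_mul_cancel₀ _ hQ]⟩
  choose P Q hQ hPQ using key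
  set d : MvPolynomial (Fin m) C := ∏ s ∈ hS.toFinset, Q s with hd
  have hdt : MvPolynomial.aeval t d ≠ 0 := by
    rw [hd, map_prod]
    exact Finset.prod_ne_zero_iff.2 fun s _ => hQ s
  obtain ⟨G, hG⟩ := (isNoetherianRing_iff_ideal_fg _).1
    (inferInstance : IsNoetherianRing (MvPolynomial (Fin m) C))
    (RingHom.ker (MvPolynomial.aeval (R := C) t))
  obtain ⟨φ, hφ, hol⟩ := exists_isQF_holds_iff G d
  have hK : RealizeRing K (algebraMap C K) φ.exs := by
    refine (holds_exs _).2 ⟨fun i => j (t i), (hol K _).2 ?_⟩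
    have hj : ∀ p : MvPolynomial (Fin m) C, MvPolynomial.aeval (fun i => j (t i)) p = j (MvPolynomial.aeval t p) := by
      intro p
      rw [← AlgHom.comp_apply, MvPolynomial.comp_aeval]
    refine ⟨fun p hp => ?_, ?_⟩
    · rw [hj, show MvPolynomial.aeval t p = 0 from RingHom.mem_ker.1 (hG.le (Ideal.subset_span hp)), map_zero]
    · rw [hj]
      exact (map_ne_zero_iff _ j.injective).2 hdt
  obtain ⟨t', ht'⟩ := (holds_exs _).1 (H _ (.base (isExistsN_exs (.qf (n := 0) hφ) (by simp))) hK)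
  obtain ⟨h0, hd'⟩ := (hol L t').1 ht'
  have hker : ∀ p : MvPolynomial (Fin m) C, MvPolynomial.aeval t p = 0 → MvPolynomial.aeval t' p = 0 := by
    intro p hp
    have h1 : Ideal.span (G : Set (MvPolynomial (Fin m) C))
        ≤ RingHom.ker (MvPolynomial.aeval (R := C) t') := Ideal.span_le.2 h0
    rw [hG] at h1
    exact h1 hp
  let ι : Localization.Away d →ₐ[C] F :=
    IsLocalization.Away.liftAlgHom d (f := MvPolynomial.aeval (R := C) t) hdt.isUnit
  let g : Localization.Away d →ₐ[C] L :=
    IsLocalization.Away.liftAlgHom d (f := MvPolynomial.aeval (R := C) t') hd'.isUnit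
  have hι : ∀ p, ι (algebraMap _ _ p) = MvPolynomial.aeval t p :=
    fun p => IsLocalization.Away.lift_eq d hdt.isUnit p
  have hg : ∀ p, g (algebraMap _ _ p) = MvPolynomial.aeval t' p :=
    fun p => IsLocalization.Away.lift_eq d hd'.isUnit p
  refine ⟨Localization.Away d, inferInstance, inferInstance, ι, g, fun x hx => ?_, fun s hs => ?_⟩
  · obtain ⟨⟨p, s⟩, hps⟩ := IsLocalization.surj (Submonoid.powers d) x
    have h1 : g x * g (algebraMap _ _ s.1) = 0 := by
      rw [← map_mul, hps, hg]
      apply hker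
      rw [← hι, ← hps, map_mul, hx, zero_mul]
    exact ((IsLocalization.map_units (Localization.Away d) s).map g).mul_left_eq_zero.1 h1
  · have hdvd : Q s ∣ d := Finset.dvd_prod_of_mem _ (hS.mem_toFinset.2 hs)
    have hu : IsUnit (algebraMap _ (Localization.Away d) (Q s)) :=
      isUnit_of_dvd_unit (map_dvd _ hdvd) (IsLocalization.Away.algebraMap_isUnit d)
    obtain ⟨z, hz⟩ := hu.exists_right_inv
    refine ⟨algebraMap _ _ (P s) * z, ?_⟩
    have h2 := congrArg ι hz
    rw [map_mul, hι, map_one] at h2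
    rw [map_mul, hι, ← hPQ, mul_assoc, h2, mul_one]

/-- A finitely generated separably generated extension of transcendence degree at most `n` is
generated by `n + 1` elements. -/
theorem exists_adjoin_range_eq_top {C F : Type u} [Field C] [Field F] [Algebra C F]
    [Algebra.EssFiniteType C F] (h : HasSepTransBasis C F) {n : ℕ} (hn : Algebra.trdeg C F ≤ n) :
    ∃ t : Fin (n + 1) → F, adjoin C (Set.range t) = ⊤ := by
  obtain ⟨s, hs, hsep⟩ := h
  have hcard : Cardinal.mk s ≤ n := hs.cardinalMk_le_trdeg.trans hn
  have : Algebra.EssFiniteType (adjoin C s) F := Algebra.EssFiniteType.of_comp C _ F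
  have : FiniteDimensional (adjoin C s) F :=
    Algebra.finite_of_essFiniteType_of_isAlgebraic
  obtain ⟨α, hα⟩ := Field.exists_primitive_element (adjoin C s) F
  have hcard' : Cardinal.mk ↥(insert α s) ≤ Cardinal.mk (ULift.{u} (Fin (n + 1))) := by
    refine (Cardinal.mk_insert_le).trans ?_
    simpa using add_le_add_left hcard 1
  obtain ⟨e⟩ := hcard'
  have : Nonempty ↥(insert α s) := ⟨⟨α, Set.mem_insert _ _⟩⟩
  refine ⟨fun i => (Function.invFun e ⟨i⟩ : ↥(insert α s)), ?_⟩
  have hr : Set.range (fun i : Fin (n + 1) => ((Function.invFun e ⟨i⟩ : ↥(insert α s)) : F))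
      = s ∪ {α} := by
    rw [Set.union_singleton]
    ext x
    constructor
    · rintro ⟨i, rfl⟩
      exact Subtype.mem _
    · intro hx
      obtain ⟨⟨i⟩, hi⟩ := Function.invFun_surjective e.injective ⟨x, hx⟩
      exact ⟨i, congrArg Subtype.val hi⟩
  rw [hr, ← adjoin_adjoin_left, hα, restrictScalars_top]

theorem trdeg_adjoin_le (C : Type u) {K : Type u} [Field C] [Field K] [Algebra C K] (B : Set K) :
    Algebra.trdeg C (adjoin C B) ≤ Cardinal.mk B := by
  let s : Set (adjoin C B) := Subtype.val ⁻¹' B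
  have hs : adjoin C s = ⊤ := by
    refine lift_injective _ ?_
    have h1 : Subtype.val '' s = B :=
      Subtype.image_preimage_coe _ _ |>.trans (Set.inter_eq_right.2 (subset_adjoin C B))
    rw [lift_top, lift_adjoin, h1]
  have : Algebra.IsAlgebraic (Algebra.adjoin C s) (adjoin C B) := by
    refine ⟨fun x => ?_⟩
    obtain ⟨a, ha, b, hb, rfl⟩ := mem_adjoin_iff_div.1 (hs ▸ mem_top : x ∈ adjoin C s)
    rw [div_eq_mul_inv]
    exact (isAlgebraic_algebraMap (⟨a, ha⟩ : Algebra.adjoin C s)).mul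
      (isAlgebraic_algebraMap (⟨b, hb⟩ : Algebra.adjoin C s)).inv
  refine (Algebra.IsAlgebraic.trdeg_le_cardinalMk C s).trans ?_
  exact Cardinal.mk_preimage_of_injective _ _ Subtype.val_injective

theorem trdeg_algebraicClosure {C F K : Type u} [Field C] [Field F] [Field K] [Algebra C F]
    [Algebra F K] [Algebra C K] [IsScalarTower C F K] :
    Algebra.trdeg C (algebraicClosure F K) = Algebra.trdeg C F := by
  have : FaithfulSMul F (algebraicClosure F K) :=
    (faithfulSMul_iff_algebraMap_injective _ _).2 (algebraMap F _).injective
  have h := trdeg_add_eq C F (A := algebraicClosure F K)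
  rw [trdeg_eq_zero (R := F), add_zero] at h
  exact h.symm

/-- Any `n ≥ 1` elements lie in a relatively algebraically closed subfield of transcendence degree
at most `n` which is infinite or everything. -/
theorem exists_intermediateField {C K : Type u} [Field C] [Field K] [Algebra C K] {n : ℕ}
    (hn : n ≠ 0) (A : Finset K) (hA : A.card ≤ n) :
    ∃ E : IntermediateField C K, (A : Set K) ⊆ E ∧ Algebra.trdeg C E ≤ n ∧
      (∀ x, IsAlgebraic E x → x ∈ E) ∧ (Infinite E ∨ E = ⊤) := by
  classical
  let cl (B : Finset K) : IntermediateField C K :=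
    (algebraicClosure (adjoin C (B : Set K)) K).restrictScalars C
  have hle (B : Finset K) : adjoin C (B : Set K) ≤ cl B := fun x hx =>
    (algebraicClosure (adjoin C (B : Set K)) K).algebraMap_mem ⟨x, hx⟩
  have htr (B : Finset K) (hB : B.card ≤ n) : Algebra.trdeg C (cl B) ≤ n := by
    have h1 : Algebra.trdeg C (adjoin C (B : Set K)) ≤ n :=
      (trdeg_adjoin_le C _).trans (by simpa using hB)
    exact (trdeg_algebraicClosure (C := C) (F := adjoin C (B : Set K)) (K := K)).trans_le h1
  have hcl (B : Finset K) (x : K) (hx : IsAlgebraic (cl B) x) : x ∈ cl B := by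
    have : x ∈ algebraicClosure (algebraicClosure (adjoin C (B : Set K)) K) K :=
      mem_algebraicClosure_iff.2 hx
    rw [algebraicClosure.algebraicClosure_eq_bot] at this
    obtain ⟨y, rfl⟩ := mem_bot.1 this
    exact y.2
  by_cases hcase : Infinite (cl A) ∨ cl A = ⊤
  · exact ⟨cl A, (subset_adjoin C _).trans (hle A), htr A hA, hcl A, hcase⟩
  · rw [not_or, not_infinite_iff_finite] at hcase
    obtain ⟨hfin, htop⟩ := hcase
    obtain ⟨t, ht⟩ : ∃ t, t ∉ cl A := by
      by_contra! h
      exact htop (eq_top_iff.2 fun x _ => h x)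
    refine ⟨cl {t}, fun a ha => ?_, htr {t} (by simpa using Nat.one_le_iff_ne_zero.2 hn), hcl _,
      .inl ?_⟩
    · have ha' : a ∈ cl A := hle A (subset_adjoin C _ ha)
      have h1 : IsAlgebraic C (⟨a, ha'⟩ : cl A) := Algebra.IsAlgebraic.isAlgebraic _
      have h2 : IsAlgebraic C a := h1.algebraMap (A := K)
      exact mem_algebraicClosure_iff.2 (h2.tower_top _)
    · have htt : t ∈ cl {t} := hle _ (subset_adjoin C _ (by simp))
      by_contra hf
      rw [not_infinite_iff_finite] at hf
      have h1 : IsAlgebraic C (⟨t, htt⟩ : cl {t}) := Algebra.IsAlgebraic.isAlgebraic _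
      have h2 : IsAlgebraic C t := h1.algebraMap (A := K)
      exact ht (mem_algebraicClosure_iff.2 (h2.tower_top _))

end Paper

namespace Paper

theorem finite_setOf_not_holds_iff_of_isQF {C K : Type u} [Field C] [Field K] [Algebra C K]
    {E : IntermediateField C K} {k : ℕ} {φ : (Language.ring[[C]]).BoundedFormula Empty (k + 1)}
    (hφ : φ.IsQF) (w : Fin k → E) {b : K} (hb : Transcendental E b) :
    {c : K | ¬ (Holds (algebraMap C K) φ (Fin.snoc (fun i => (w i : K)) c) ↔
      Holds (algebraMap C K) φ (Fin.snoc (fun i => (w i : K)) b))}.Finite := by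
  induction hφ with
  | falsum => simp [Holds, BoundedFormula.Realize]
  | of_isAtomic h =>
    cases h with
    | equal τ σ =>
      obtain ⟨p, hp⟩ := exists_mvPolynomial_termVal.{u} τ
      obtain ⟨q, hq⟩ := exists_mvPolynomial_termVal.{u} σ
      let P : Polynomial E := MvPolynomial.aeval
        (Fin.snoc (fun i => Polynomial.C (w i)) Polynomial.X : Fin (k + 1) → Polynomial E) (p - q)
      have hP (c : K) : Holds (algebraMap C K) (τ.bdEqual σ) (Fin.snoc (fun i => (w i : K)) c) ↔
          Polynomial.aeval c P = 0 := by
        rw [holds_equal, hp, hq, ← sub_eq_zero, ← map_sub]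
        have h1 : (fun i => (Polynomial.aeval (R := E) c).restrictScalars C
            ((Fin.snoc (fun i => Polynomial.C (w i)) Polynomial.X : Fin (k + 1) → Polynomial E) i))
            = Fin.snoc (fun i => (w i : K)) c := by
          funext i
          refine Fin.lastCases ?_ (fun i => ?_) i <;> simp
        rw [← h1, ← MvPolynomial.comp_aeval]
        rfl
      simp only [hP]
      by_cases h0 : P = 0
      · simp [h0]
      · refine (P.rootSet_finite K).subset fun c hc => ?_
        have hbP : Polynomial.aeval b P ≠ 0 := fun h => hb ⟨P, h0, h⟩
        rw [Set.mem_ofPred_eq, iff_false_right hbP, not_not] at hc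
        exact (Polynomial.mem_rootSet_of_ne h0).2 hc
    | rel R ts => exact (elim_ring_relations R).elim
  | imp _ _ ih₁ ih₂ =>
    refine (ih₁.union ih₂).subset fun c hc => ?_
    simp only [Set.mem_ofPred_eq, Set.mem_union, holds_imp] at hc ⊢
    tauto

/-- A relatively algebraically closed subfield that is infinite or improper. -/
def IsLargeRelClosed {C K : Type u} [Field C] [Field K] [Algebra C K]
    (E : IntermediateField C K) : Prop :=
  (∀ x, IsAlgebraic E x → x ∈ E) ∧ (Infinite E ∨ E = ⊤)

theorem holds_val_iff_of_isQF {C K : Type u} [Field C] [Field K] [Algebra C K]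
    (E : IntermediateField C K) {k : ℕ} {φ : (Language.ring[[C]]).BoundedFormula Empty k}
    (hφ : φ.IsQF) (w : Fin k → E) :
    Holds (algebraMap C K) φ (fun i => (w i : K)) ↔ Holds (algebraMap C E) φ w := by
  obtain ⟨S, -, h⟩ := exists_finset_holds_iff_of_isQF hφ w
  exact (h E K (AlgHom.id C E) E.val (fun x hx => by rw [show x = 0 from hx, map_zero])
    (fun x _ => ⟨x, rfl⟩) w fun _ => rfl).symm

theorem IsLargeRelClosed.holds_ex_of_isQF {C K : Type u} [Field C] [Field K] [Algebra C K]
    {E : IntermediateField C K} (hE : IsLargeRelClosed E) {k : ℕ}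
    {φ : (Language.ring[[C]]).BoundedFormula Empty (k + 1)} (hφ : φ.IsQF) (w : Fin k → E)
    (h : Holds (algebraMap C K) φ.ex fun i => (w i : K)) : Holds (algebraMap C E) φ.ex w := by
  obtain ⟨b, hb⟩ := (holds_ex _ _).1 h
  suffices ∃ c : E, Holds (algebraMap C K) φ (Fin.snoc (fun i => (w i : K)) c) by
    obtain ⟨c, hc⟩ := this
    refine (holds_ex _ _).2 ⟨c, (holds_val_iff_of_isQF E hφ _).1 ?_⟩
    convert hc using 1
    funext i
    refine Fin.lastCases ?_ (fun i => ?_) i <;> simp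
  by_cases hbE : b ∈ E
  · exact ⟨⟨b, hbE⟩, hb⟩
  have hinf : Infinite E := hE.2.resolve_right fun h => hbE (h ▸ IntermediateField.mem_top)
  have hfin := finite_setOf_not_holds_iff_of_isQF hφ w fun h => hbE (hE.1 b h)
  obtain ⟨c, hc⟩ := (hfin.preimage (Subtype.val_injective.injOn (s := (Set.univ : Set E)).mono
    (Set.subset_univ _))).exists_notMem
  exact ⟨c, (not_not.1 hc).2 hb⟩

theorem IsLargeRelClosed.holds_of_isE1 {C K : Type u} [Field C] [Field K] [Algebra C K]
    {E : IntermediateField C K} (hE : IsLargeRelClosed E) {k : ℕ}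
    {φ : (Language.ring[[C]]).BoundedFormula Empty k} (hφ : IsE1 φ) (w : Fin k → E)
    (h : Holds (algebraMap C K) φ fun i => (w i : K)) : Holds (algebraMap C E) φ w := by
  unfold IsE1 at hφ
  induction hφ with
  | base hφ =>
    rcases hφ with hφ | ⟨ψ, hψ, rfl⟩
    · exact (holds_val_iff_of_isQF E hφ w).1 h
    · exact hE.holds_ex_of_isQF hψ w h
  | inf _ _ ih₁ ih₂ =>
    rw [holds_inf] at h ⊢
    exact ⟨ih₁ h.1, ih₂ h.2⟩
  | sup _ _ ih₁ ih₂ =>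
    rw [holds_sup] at h ⊢
    exact h.imp ih₁ ih₂

/-- An `∃_n∃₁`-formula true in `K` descends to every large enough subfield containing suitable
`n` elements. -/
theorem exists_finset_holds_of_isExistsNE1 {C K : Type u} [Field C] [Field K] [Algebra C K]
    {n k : ℕ} {φ : (Language.ring[[C]]).BoundedFormula Empty k} (hφ : IsExistsNE1 n φ)
    {v : Fin k → K} (h : Holds (algebraMap C K) φ v) :
    ∃ A : Finset K, A.card ≤ n ∧ ∀ E : IntermediateField C K, IsLargeRelClosed E →
      (A : Set K) ⊆ E → ∀ w : Fin k → E, (∀ i, (w i : K) = v i) → Holds (algebraMap C E) φ w := by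
  classical
  induction hφ with
  | e1 hφ =>
    refine ⟨∅, by simp, fun E hE _ w hw => hE.holds_of_isE1 hφ w ?_⟩
    rwa [show (fun i => (w i : K)) = v from funext hw]
  | ex _ ih =>
    obtain ⟨x, hx⟩ := (holds_ex _ _).1 h
    obtain ⟨A, hA, H⟩ := ih hx
    refine ⟨insert x A, (Finset.card_insert_le _ _).trans (by omega), fun E hE hAE w hw => ?_⟩
    rw [Finset.coe_insert, Set.insert_subset_iff] at hAE
    refine (holds_ex _ _).2 ⟨⟨x, hAE.1⟩, H E hE hAE.2 _ fun i => ?_⟩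
    refine Fin.lastCases ?_ (fun i => ?_) i <;> simp [hw]

theorem holds_of_isExistsNE1 {n : ℕ} {C K L : Type u} [Field C] [Field K] [Algebra C K]
    (hsep : IsSepExt C K) [Field L] [Algebra C L]
    (H : ThRingSub (fun {_} φ => IsExistsN (n + 1) φ) K (algebraMap C K) L (algebraMap C L))
    (hn : n ≠ 0) {φ : (Language.ring[[C]]).Sentence} (hφ : IsExistsNE1 n φ)
    (h : RealizeRing K (algebraMap C K) φ) : RealizeRing L (algebraMap C L) φ := by
  classical
  obtain ⟨A, hA, hAE⟩ := exists_finset_holds_of_isExistsNE1 hφ (v := default) h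
  obtain ⟨E, hAE', htr, hcl, hinf⟩ := exists_intermediateField (C := C) hn A hA
  have hE := hAE E ⟨hcl, hinf⟩ hAE' default fun i => i.elim0
  obtain ⟨S, hS, hSE⟩ := exists_transfers_of_isExistsNE1 hφ hE
  let B : Finset K := hS.toFinset.image Subtype.val
  have hBE : IntermediateField.adjoin C (B : Set K) ≤ E := by
    rw [IntermediateField.adjoin_le_iff]
    intro x hx
    obtain ⟨y, -, rfl⟩ := Finset.mem_image.1 hx
    exact y.2
  let i := IntermediateField.inclusion hBE
  have : Algebra.EssFiniteType C (IntermediateField.adjoin C (B : Set K)) :=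
    (IntermediateField.essFiniteType_iff).2 ⟨B, rfl⟩
  obtain ⟨t, ht⟩ := exists_adjoin_range_eq_top (hsep B)
    ((trdeg_le_of_injective i i.injective).trans htr)
  obtain ⟨R, _, _, ι, g, hker, hι⟩ := exists_algHom_of_thRingSub H
    (IntermediateField.adjoin C (B : Set K)).val t ht (i ⁻¹' S)
    (hS.preimage i.injective.injOn)
  have hL := hSE R L (i.comp ι) g
    (fun x hx => hker x (i.injective (by rw [map_zero]; exact hx))) ?_ default fun i => i.elim0
  · rwa [Subsingleton.elim (fun k : Fin 0 => g _) default] at hL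
  · intro s hs
    have hsB : (s : K) ∈ IntermediateField.adjoin C (B : Set K) :=
      IntermediateField.subset_adjoin C _
        (Finset.mem_coe.2 (Finset.mem_image_of_mem _ (hS.mem_toFinset.2 hs)))
    have his : i ⟨s, hsB⟩ = s := Subtype.ext rfl
    obtain ⟨r, hr⟩ := hι (show i ⟨s, hsB⟩ ∈ S by rwa [his])
    exact ⟨r, (congrArg i hr).trans his⟩

/-- Proposition `prop:efd` of the paper.
Let `K` and `L` be two separable field extensions of a field `C` and `n ∈ ℕ`.  Then
`Th_{∃_n∃_1}(K, C) ⊆ Th_{∃_n∃_1}(L, C)` iff `Th_{∃_{n+1}}(K, C) ⊆ Th_{∃_{n+1}}(L, C)`. -/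
theorem statement13 (n : ℕ) (C : Type u) [Field C]
    (K : Type u) [Field K] [Algebra C K] (hsepK : IsSepExt C K)
    (L : Type u) [Field L] [Algebra C L] (hsepL : IsSepExt C L) :
    ThRingSub (fun {k} φ => IsExistsNE1 n φ) K (algebraMap C K) L (algebraMap C L) ↔
    ThRingSub (fun {k} φ => IsExistsN (n + 1) φ) K (algebraMap C K) L (algebraMap C L) := by
  refine ⟨fun H φ hφ => H φ (hφ.mono fun _ h => h.isExistsNE1), fun H φ hφ h => ?_⟩
  by_cases hn : n = 0
  · subst hn
    refine H φ ?_ h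
    clear h
    induction hφ with
    | base hφ =>
      cases hφ with
      | e1 hφ =>
        refine IsPosBC.mono (fun ψ hψ => ?_) hφ
        rcases hψ with hψ | ⟨χ, hχ, rfl⟩
        · exact .qf hψ
        · exact .ex (.qf hχ)
    | inf _ _ ih₁ ih₂ => exact .inf ih₁ ih₂
    | sup _ _ ih₁ ih₂ => exact .sup ih₁ ih₂
  · induction hφ with
    | base hφ => exact holds_of_isExistsNE1 hsepK H hn hφ h
    | inf _ _ ih₁ ih₂ => exact (holds_inf _ _).2 (((holds_inf _ _).1 h).imp ih₁ ih₂)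
    | sup _ _ ih₁ ih₂ => exact (holds_sup _ _).2 (((holds_sup _ _).1 h).imp ih₁ ih₂)

end Paper
end

section
/- If resolution of singularities holds up to dimension n, then (R4_{n+1}) holds: whenever a valuation u on a field E is trivial on a large subfield F of E with residue field Eu = F (identified via the residue map), every ∃_{n+1}-L_ring(F)-sentence true in E is true in F. -/
open FirstOrder FirstOrder.Language

universe u v w x

namespace Paper

open AlgebraicGeometry CategoryTheory

/-- A commutative ring is regular local if it is a Noetherian local ring whose maximal ideal
is generated by `dim R` many elements. -/
def IsRegularLocal (R : Type*) [CommRing R] : Prop :=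
  ∃ h : IsLocalRing R, IsNoetherianRing R ∧
    ∃ s : Finset R,
      Ideal.span (s : Set R) = (letI := h; IsLocalRing.maximalIdeal R) ∧
      (s.card : WithBot ℕ∞) = ringKrullDim R

/-- A scheme is regular if all of its stalks are regular local rings. -/
def Scheme.IsRegular (X : Scheme.{u}) : Prop :=
  ∀ x : X, IsRegularLocal (X.presheaf.stalk x)

/-- `X` (with structure morphism `f`) is a `K`-variety: an integral separated `K`-scheme of
finite type. -/
def IsVariety {K : Type u} [Field K] {X : Scheme.{u}}
    (f : X ⟶ Spec (CommRingCat.of K)) : Prop :=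
  IsIntegral X ∧ IsSeparated f ∧ LocallyOfFiniteType f ∧ QuasiCompact f

/-- A morphism of schemes is birational if it restricts to an isomorphism over some nonempty
open subscheme (for integral schemes this is the usual notion). -/
def IsBirationalMor {X Y : Scheme.{u}} (g : Y ⟶ X) : Prop :=
  ∃ U : X.Opens, (U : Set X).Nonempty ∧ IsIso (g ∣_ U)

/-- Resolution of singularities holds up to dimension `n`: for every field `K` and every
`K`-variety `X` with `dim X ≤ n` there are a regular `K`-variety `Y` and a proper birational
morphism `Y ⟶ X`. -/
def ResolutionUpTo (n : ℕ) : Prop :=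
  ∀ (K : Type u) [Field K] (X : Scheme.{u}) (f : X ⟶ Spec (CommRingCat.of K)),
    IsVariety f → topologicalKrullDim X ≤ (n : ℕ∞) →
    ∃ (Y : Scheme.{u}) (g : Y ⟶ X),
      IsVariety (g ≫ f) ∧ Scheme.IsRegular Y ∧ IsProper g ∧ IsBirationalMor g

section LocalAlgebra

open IsLocalRing

/-- If `s` is a nonzero nonunit of a domain `S` over `F` such that every element of `S` is congruent
modulo `s` to an element of `F`, then the `s`-adic expansion is an algebra homomorphism to the power
series ring. -/
lemma exists_algHom_powerSeries {F S : Type*} [Field F] [CommRing S] [IsDomain S] [Algebra F S]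
    {s : S} (hs0 : s ≠ 0) (hs : ¬ IsUnit s) (hres : ∀ x : S, ∃ c : F, s ∣ x - algebraMap F S c) :
    ∃ φ : S →ₐ[F] PowerSeries F, φ s = PowerSeries.X := by
  choose c D hD using hres
  have hcD : ∀ x, x = algebraMap F S (c x) + s * D x := fun x => by rw [← hD x]; ring
  have huniq : ∀ (x : S) (a : F) (y : S), x = algebraMap F S a + s * y → c x = a ∧ D x = y := by
    intro x a y h
    have h1 : algebraMap F S (c x - a) = s * (y - D x) := by
      rw [map_sub]; linear_combination h - hcD x
    have h2 : c x = a := by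
      by_contra hne
      have : IsUnit (algebraMap F S (c x - a)) :=
        (IsUnit.mk0 _ (sub_ne_zero.mpr hne)).map _
      rw [h1] at this
      exact hs (isUnit_of_mul_isUnit_left this)
    refine ⟨h2, ?_⟩
    rw [h2, sub_self, map_zero] at h1
    have := (mul_eq_zero.mp h1.symm).resolve_left hs0
    exact (sub_eq_zero.mp this).symm
  have hadd : ∀ x y, c (x + y) = c x + c y ∧ D (x + y) = D x + D y := fun x y =>
    huniq _ _ _ (by rw [map_add]; linear_combination hcD x + hcD y)
  have hmul : ∀ x y, c (x * y) = c x * c y ∧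
      D (x * y) = D x * y + algebraMap F S (c x) * D y := fun x y =>
    huniq _ _ _ (by
      rw [map_mul]
      linear_combination y * hcD x + algebraMap F S (c x) * hcD y)
  have halg : ∀ a : F, c (algebraMap F S a) = a ∧ D (algebraMap F S a) = 0 := fun a =>
    huniq _ _ _ (by ring)
  have hs' : c s = 0 ∧ D s = 1 := huniq _ _ _ (by rw [map_zero]; ring)
  let Φ : S → PowerSeries F := fun x => PowerSeries.mk fun n => c (D^[n] x)
  have hΦ : ∀ x, Φ x = PowerSeries.C (c x) + PowerSeries.X * Φ (D x) := by
    intro x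
    ext n
    cases n with
    | zero => simp [Φ]
    | succ n => simp [Φ, PowerSeries.coeff_succ_X_mul]
  have hzero : D 0 = 0 ∧ c 0 = 0 := by simpa [and_comm] using halg 0
  have hΦalg : ∀ a : F, Φ (algebraMap F S a) = PowerSeries.C a := by
    intro a
    have h0 : Φ 0 = 0 := by
      ext n
      have : D^[n] 0 = 0 := Function.iterate_fixed hzero.1 n
      simp [Φ, this, hzero.2]
    rw [hΦ, (halg a).1, (halg a).2, h0, mul_zero, add_zero]
  have hΦadd : ∀ x y, Φ (x + y) = Φ x + Φ y := by
    intro x y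
    ext n
    induction n generalizing x y with
    | zero => simp [Φ, (hadd x y).1]
    | succ n ih =>
      have := ih (D x) (D y)
      rw [hΦ (x + y), hΦ x, hΦ y, (hadd x y).2]
      simp only [map_add, PowerSeries.coeff_succ_X_mul, PowerSeries.coeff_C,
        Nat.succ_ne_zero, if_false, zero_add] at this ⊢
      exact this
  have hΦmul : ∀ x y, Φ (x * y) = Φ x * Φ y := by
    intro x y
    ext n
    induction n generalizing x y with
    | zero => simp [Φ, (hmul x y).1, PowerSeries.coeff_mul]
    | succ n ih =>
      have e : Φ x * Φ y = PowerSeries.C (c x) * (PowerSeries.C (c y) + PowerSeries.X * Φ (D y))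
          + PowerSeries.X * (Φ (D x) * Φ y) := by
        rw [← hΦ y]; conv_lhs => rw [hΦ x]
        ring
      rw [e, hΦ (x * y), (hmul x y).2, hΦadd]
      simp only [map_add, mul_add, PowerSeries.coeff_succ_X_mul, ih, PowerSeries.coeff_C,
        Nat.succ_ne_zero, if_false, PowerSeries.coeff_C_mul, mul_zero, zero_add, hΦalg]
      ring
  refine ⟨{ toFun := Φ, map_one' := ?_, map_mul' := hΦmul, map_zero' := ?_, map_add' := hΦadd,
            commutes' := hΦalg }, ?_⟩
  · simpa using hΦalg 1
  · simpa using hΦalg 0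
  · change Φ s = _
    rw [hΦ, hs'.1, hs'.2]
    have : Φ 1 = 1 := by simpa using hΦalg 1
    simp [this]

/-- In a Noetherian local ring with principal maximal ideal, every nonzero element is a unit times
a power of the generator. -/
lemma exists_eq_unit_mul_pow {S : Type*} [CommRing S] [IsLocalRing S] [IsNoetherianRing S]
    {s : S} (hs : maximalIdeal S = Ideal.span {s}) {x : S} (hx : x ≠ 0) :
    ∃ (k : ℕ) (v : S), IsUnit v ∧ x = v * s ^ k := by
  have hinf := Ideal.iInf_pow_eq_bot_of_isLocalRing (maximalIdeal S) (Ideal.IsPrime.ne_top')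
  have hex : ∃ k, x ∉ maximalIdeal S ^ k := by
    by_contra! h
    exact hx (by simpa [hinf] using (Ideal.mem_iInf.mpr h : x ∈ ⨅ k, maximalIdeal S ^ k))
  classical
  obtain ⟨k, hk, hmin⟩ : ∃ k, x ∉ maximalIdeal S ^ k ∧ ∀ j < k, x ∈ maximalIdeal S ^ j :=
    ⟨Nat.find hex, Nat.find_spec hex, fun j hj => not_not.mp (Nat.find_min hex hj)⟩
  obtain _ | k := k
  · simp at hk
  have hmem := hmin k (Nat.lt_succ_self k)
  rw [hs, Ideal.span_singleton_pow, Ideal.mem_span_singleton'] at hmem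
  obtain ⟨v, rfl⟩ := hmem
  refine ⟨k, v, ?_, rfl⟩
  by_contra hv
  have hv' : v ∈ maximalIdeal S := hv
  apply hk
  rw [pow_succ']
  refine Ideal.mul_mem_mul hv' (Ideal.pow_mem_pow ?_ _)
  rw [hs]; exact Ideal.mem_span_singleton_self s

/-- A Noetherian local ring with principal, non-nilpotent maximal ideal is a domain. -/
lemma isDomain_of_maximalIdeal_principal {S : Type*} [CommRing S] [IsLocalRing S]
    [IsNoetherianRing S] {s : S} (hs : maximalIdeal S = Ideal.span {s}) (hn : ¬ IsNilpotent s) :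
    IsDomain S := by
  have : NoZeroDivisors S := ⟨by
    intro a b hab
    by_contra! h
    obtain ⟨k, v, hv, rfl⟩ := exists_eq_unit_mul_pow hs h.1
    obtain ⟨l, w, hw, rfl⟩ := exists_eq_unit_mul_pow hs h.2
    refine hn ⟨k + l, ?_⟩
    have : (v * w) * s ^ (k + l) = 0 := by rw [← hab]; ring
    exact ((hv.mul hw).mul_right_eq_zero).mp this⟩
  exact NoZeroDivisors.to_isDomain S

/-- A homogeneous polynomial of degree `k` scales by the `k`-th power. -/
lemma eval_mul_of_isHomogeneous {σ R : Type*} [CommRing R] {p : MvPolynomial σ R} {k : ℕ}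
    (hp : p.IsHomogeneous k) (r : R) (a : σ → R) :
    MvPolynomial.eval (fun i => r * a i) p = r ^ k * MvPolynomial.eval a p := by
  rw [MvPolynomial.eval_eq, MvPolynomial.eval_eq, Finset.mul_sum]
  refine Finset.sum_congr rfl fun d hd => ?_
  have hd' : ∑ i ∈ d.support, d i = k := by
    have := hp (MvPolynomial.mem_support_iff.mp hd)
    rwa [Finsupp.weight_apply, Finsupp.sum, Finset.sum_congr rfl (g := fun i => d i)] at this
    intro i _
    simp
  simp_rw [mul_pow]
  rw [Finset.prod_mul_distrib, Finset.prod_pow_eq_pow_sum, hd']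
  ring

/-- A form of degree `k` with coefficients in `I`, evaluated at `t`, lies in `I * (t) ^ k`. -/
lemma eval_mem_mul_pow {σ R : Type*} [CommRing R] {p : MvPolynomial σ R} {k : ℕ}
    (hp : p.IsHomogeneous k) (t : σ → R) {I : Ideal R} (hI : ∀ d, p.coeff d ∈ I) :
    MvPolynomial.eval t p ∈ I * Ideal.span (Set.range t) ^ k := by
  rw [MvPolynomial.eval_eq]
  refine Ideal.sum_mem _ fun d hd => Ideal.mul_mem_mul (hI d) ?_
  rw [Ideal.mem_span_pow_iff_exists_isHomogeneous]
  refine ⟨MvPolynomial.monomial d 1, MvPolynomial.isHomogeneous_monomial _ ?_, ?_⟩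
  · have := hp (MvPolynomial.mem_support_iff.mp hd)
    rw [Finsupp.degree_eq_weight_one]
    exact this
  · rw [MvPolynomial.eval_monomial, one_mul, Finsupp.prod]

/-- A local `F`-algebra with residue field `F` has an `F`-algebra map to `F` whose kernel is the
maximal ideal. -/
lemma exists_residue_algHom {F R : Type*} [Field F] [CommRing R] [IsLocalRing R] [Algebra F R]
    (hres : ∀ r : R, ∃ c : F, r - algebraMap F R c ∈ maximalIdeal R) :
    ∃ ε : R →ₐ[F] F, ∀ r, ε r = 0 ↔ r ∈ maximalIdeal R := by
  have hb : Function.Bijective (algebraMap F (ResidueField R)) := by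
    refine ⟨(algebraMap F (ResidueField R)).injective, fun y => ?_⟩
    obtain ⟨r, rfl⟩ := residue_surjective y
    obtain ⟨c, hc⟩ := hres r
    refine ⟨c, ?_⟩
    rw [← residue_eq_zero_iff, map_sub, sub_eq_zero] at hc
    rw [hc]
    rfl
  let e := AlgEquiv.ofBijective (Algebra.ofId F (ResidueField R)) hb
  refine ⟨(e.symm : ResidueField R →ₐ[F] F).comp (IsScalarTower.toAlgHom F R (ResidueField R)),
    fun r => ?_⟩
  rw [← residue_eq_zero_iff]
  simp

/-- The maximal ideal of a Noetherian local ring is not the radical of an ideal with fewer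
generators than the dimension of the ring. -/
lemma not_maximalIdeal_le_radical {R : Type*} [CommRing R] [IsLocalRing R] [IsNoetherianRing R]
    {s : Finset R} (hcard : (s.card : WithBot ℕ∞) < ringKrullDim R)
    (hs : Ideal.span (s : Set R) ≤ maximalIdeal R) :
    ¬ maximalIdeal R ≤ (Ideal.span (s : Set R)).radical := by
  intro h
  have h1 : (maximalIdeal R).height ≤ (Ideal.span (s : Set R)).height := by
    rw [Ideal.height_eq_inf_minimalPrimes (Ideal.span (s : Set R))]
    refine le_iInf₂ fun P hP => Ideal.height_mono ?_
    exact h.trans (hP.1.1.radical_le_iff.mpr hP.1.2)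
  have h2 := Ideal.height_le_spanFinrank (Ideal.span (s : Set R))
    (ne_top_of_le_ne_top Ideal.IsPrime.ne_top' hs)
  have h3 : (Ideal.span (s : Set R)).spanFinrank ≤ s.card := by
    simpa using Submodule.spanFinrank_span_le_ncard_of_finite (R := R) s.finite_toSet
  have h4 : (maximalIdeal R).height ≤ (s.card : ℕ∞) := (h1.trans h2).trans (by exact_mod_cast h3)
  rw [← maximalIdeal_height_eq_ringKrullDim] at hcard
  exact absurd hcard (not_lt.mpr (by exact_mod_cast h4))

/-- A regular local `F`-algebra with infinite residue field `F` has, for every nonzero element, an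
`F`-algebra map to the power series ring that does not kill it. -/
theorem exists_algHom_powerSeries_of_regular {F R : Type*} [Field F] [Infinite F] [CommRing R]
    [IsLocalRing R] [IsNoetherianRing R] [Algebra F R]
    (hres : ∀ r : R, ∃ c : F, r - algebraMap F R c ∈ maximalIdeal R) (s : Finset R)
    (hspan : Ideal.span (s : Set R) = maximalIdeal R)
    (hcard : (s.card : WithBot ℕ∞) = ringKrullDim R) {f : R} (hf : f ≠ 0) :
    ∃ φ : R →ₐ[F] PowerSeries F, φ f ≠ 0 := by
  classical
  obtain ⟨ε, hε⟩ := exists_residue_algHom hres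
  have hinf := Ideal.iInf_pow_eq_bot_of_isLocalRing (maximalIdeal R) (Ideal.IsPrime.ne_top')
  have hex : ∃ k, f ∉ maximalIdeal R ^ k := by
    by_contra! h
    exact hf (by simpa [hinf] using (Ideal.mem_iInf.mpr h : f ∈ ⨅ k, maximalIdeal R ^ k))
  obtain ⟨k, hk, hmin⟩ : ∃ k, f ∉ maximalIdeal R ^ k ∧ ∀ j < k, f ∈ maximalIdeal R ^ j :=
    ⟨Nat.find hex, Nat.find_spec hex, fun j hj => not_not.mp (Nat.find_min hex hj)⟩
  obtain _ | k := k
  · simp at hk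
  have hmem := hmin k (Nat.lt_succ_self k)
  obtain rfl | hk0 := Nat.eq_zero_or_pos k
  · refine ⟨(Algebra.ofId F (PowerSeries F)).comp ε, ?_⟩
    rw [zero_add, pow_one, ← hε] at hk
    simpa [Algebra.ofId_apply] using hk
  have hrange : Set.range (Subtype.val : s → R) = s := by simp
  rw [← hspan, ← hrange, Ideal.mem_span_pow_iff_exists_isHomogeneous] at hmem
  obtain ⟨p, hp, hpf⟩ := hmem
  set q : MvPolynomial s F := MvPolynomial.map (ε : R →+* F) p with hq
  have hqhom : q.IsHomogeneous k := hp.map _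
  have hq0 : q ≠ 0 := by
    intro h0
    apply hk
    rw [pow_succ', ← hpf]
    have := eval_mem_mul_pow hp (Subtype.val : s → R) (I := maximalIdeal R) fun d => by
      rw [← hε]
      have := congrArg (MvPolynomial.coeff d) h0
      simpa [hq, MvPolynomial.coeff_map] using this
    rwa [hrange, hspan] at this
  obtain ⟨c, hc⟩ : ∃ c : s → F, MvPolynomial.eval c q ≠ 0 := by
    by_contra! h
    exact hq0 (MvPolynomial.funext fun c => by simpa using h c)
  obtain ⟨j, hj⟩ : ∃ j, c j ≠ 0 := by
    by_contra! h
    apply hc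
    have := eval_mul_of_isHomogeneous hqhom 0 c
    rw [zero_pow hk0.ne', zero_mul] at this
    rw [← this]
    simp [show c = fun _ => 0 from funext h]
  set b : s → F := fun i => c i / c j with hb
  have hbq : MvPolynomial.eval b q ≠ 0 := by
    have : MvPolynomial.eval b q = (c j)⁻¹ ^ k * MvPolynomial.eval c q := by
      rw [← eval_mul_of_isHomogeneous hqhom]
      congr 2
      ext1 i
      exact div_eq_inv_mul _ _
    rw [this]
    exact mul_ne_zero (pow_ne_zero _ (inv_ne_zero hj)) hc
  let g : s → R := fun i => (i : R) - algebraMap F R (b i) * j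
  have hsm : ∀ i : s, (i : R) ∈ maximalIdeal R := fun i => by
    rw [← hspan]; exact Ideal.subset_span i.2
  set T : Finset R := (Finset.univ.erase j).image g with hT
  set J : Ideal R := Ideal.span (T : Set R) with hJ
  have hgJ : ∀ i, g i ∈ J := by
    intro i
    by_cases hij : i = j
    · have : g i = 0 := by simp [g, hij, b, hj]
      rw [this]; exact J.zero_mem
    · exact Ideal.subset_span (by
        rw [hT]; exact Finset.mem_coe.mpr (Finset.mem_image_of_mem _ (by simp [hij])))
  have hJm : J ≤ maximalIdeal R := by
    rw [hJ, Ideal.span_le]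
    intro x hx
    obtain ⟨i, -, rfl⟩ := Finset.mem_image.mp (Finset.mem_coe.mp hx)
    exact Ideal.sub_mem _ (hsm i) (Ideal.mul_mem_left _ _ (hsm j))
  have hTcard : T.card < s.card := by
    refine lt_of_le_of_lt Finset.card_image_le ?_
    rw [Finset.card_erase_of_mem (Finset.mem_univ _), Finset.card_univ, Fintype.card_coe]
    exact Nat.sub_lt (Finset.card_pos.mpr ⟨j, j.2⟩) one_pos
  have hrad := not_maximalIdeal_le_radical (s := T)
    (by rw [← hcard]; exact_mod_cast hTcard) hJm
  have hnt : Nontrivial (R ⧸ J) :=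
    Ideal.Quotient.nontrivial_iff.mpr (ne_top_of_le_ne_top Ideal.IsPrime.ne_top' hJm)
  let π : R →ₐ[F] R ⧸ J := Ideal.Quotient.mkₐ F J
  have hπ : Function.Surjective π := Ideal.Quotient.mkₐ_surjective F J
  have hπ0 : ∀ x, π x = 0 ↔ x ∈ J := fun x => Ideal.Quotient.eq_zero_iff_mem
  have hloc : IsLocalRing (R ⧸ J) := IsLocalRing.of_surjective' (π : R →+* R ⧸ J) hπ
  have hπi : ∀ i : s, π i = algebraMap F _ (b i) * π j := fun i => by
    have := (hπ0 _).mpr (hgJ i)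
    rw [map_sub, map_mul, AlgHom.commutes, sub_eq_zero] at this
    exact this
  have hmax : maximalIdeal (R ⧸ J) = Ideal.span {π j} := by
    rw [← map_maximalIdeal_of_surjective (π : R →+* R ⧸ J) hπ, ← hspan, Ideal.map_span]
    apply le_antisymm
    · rw [Ideal.span_le]
      rintro _ ⟨x, hx, rfl⟩
      exact Ideal.mem_span_singleton'.mpr ⟨_, (hπi ⟨x, hx⟩).symm⟩
    · rw [Ideal.span_singleton_le_iff_mem]
      exact Ideal.subset_span ⟨j, j.2, rfl⟩
  have hnil : ¬ IsNilpotent (π j) := by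
    rintro ⟨N, hN⟩
    apply hrad
    rw [← hspan, Ideal.span_le]
    intro x hx
    refine ⟨N, ?_⟩
    rw [← hJ, ← hπ0, map_pow]
    have := hπi ⟨x, hx⟩
    rw [this, mul_pow, hN, mul_zero]
  have hdom : IsDomain (R ⧸ J) := isDomain_of_maximalIdeal_principal hmax hnil
  obtain ⟨φ, hφ⟩ := exists_algHom_powerSeries (F := F) (s := π j)
    (fun h => hnil (by rw [h]; exact IsNilpotent.zero))
    (by
      have : π j ∈ maximalIdeal (R ⧸ J) := hmax ▸ Ideal.mem_span_singleton_self _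
      exact this)
    (fun x => by
      obtain ⟨r, rfl⟩ := hπ x
      obtain ⟨a, ha⟩ := hres r
      refine ⟨a, ?_⟩
      rw [← Ideal.mem_span_singleton, ← hmax,
        ← map_maximalIdeal_of_surjective (π : R →+* R ⧸ J) hπ, ← AlgHom.commutes π, ← map_sub]
      exact Ideal.mem_map_of_mem _ ha)
  set ψ : R →ₐ[F] PowerSeries F := φ.comp π with hψ
  have hψm : ∀ r ∈ maximalIdeal R, PowerSeries.constantCoeff (ψ r) = 0 := by
    intro r hr
    have : π r ∈ maximalIdeal (R ⧸ J) := by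
      rw [← map_maximalIdeal_of_surjective (π : R →+* R ⧸ J) hπ]
      exact Ideal.mem_map_of_mem _ hr
    rw [hmax, Ideal.mem_span_singleton'] at this
    obtain ⟨a, ha⟩ := this
    simp [hψ, ← ha, hφ]
  have hψε : (PowerSeries.constantCoeff (R := F)).comp (ψ : R →+* PowerSeries F) = ε := by
    ext r
    have h1 : r - algebraMap F R (ε r) ∈ maximalIdeal R := by
      rw [← hε, map_sub, AlgHom.commutes]; simp
    have := hψm _ h1
    rw [map_sub, map_sub, AlgHom.commutes, sub_eq_zero] at this
    simpa [PowerSeries.algebraMap_apply] using this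
  refine ⟨ψ, ?_⟩
  set P := MvPolynomial.map (ψ : R →+* PowerSeries F) p with hP
  have hPhom : P.IsHomogeneous k := hp.map _
  have h1 : ψ f = PowerSeries.X ^ k * MvPolynomial.eval (fun i => PowerSeries.C (b i)) P := by
    rw [← eval_mul_of_isHomogeneous hPhom, ← hpf]
    change (ψ : R →+* PowerSeries F) _ = _
    rw [MvPolynomial.eval, MvPolynomial.coe_eval₂Hom, MvPolynomial.hom_eval₂, hP,
      MvPolynomial.eval_map, RingHom.comp_id]
    congr 1
    ext1 i
    simp [hψ, hπi i, hφ, mul_comm]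
  rw [h1]
  refine mul_ne_zero (pow_ne_zero _ PowerSeries.X_ne_zero) fun h => hbq ?_
  have := congrArg (PowerSeries.constantCoeff (R := F)) h
  rw [map_zero, MvPolynomial.eval, MvPolynomial.coe_eval₂Hom, MvPolynomial.hom_eval₂, hP,
    MvPolynomial.eval₂_map, RingHom.comp_id, hψε] at this
  rw [hq, MvPolynomial.eval_map, ← this]
  congr 1

end LocalAlgebra

/-- A dominant point of the target with values in a field lifts along a birational morphism. -/
lemma exists_lift_of_isBirationalMor {A K : Type u} [CommRing A] [IsDomain A] [Field K]
    (i : A →+* K) (hi : Function.Injective i) {Y : Scheme.{u}}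
    (g : Y ⟶ Spec (CommRingCat.of A)) (hg : IsBirationalMor g) :
    ∃ l : Spec (CommRingCat.of K) ⟶ Y, l ≫ g = Spec.map (CommRingCat.ofHom i) := by
  obtain ⟨U, ⟨x, hx⟩, hU⟩ := hg
  have hrange : Set.range (Spec.map (CommRingCat.ofHom i)) ⊆ Set.range U.ι := by
    rintro _ ⟨y, rfl⟩
    rw [Scheme.Opens.range_ι]
    refine Specializes.mem_open ?_ U.isOpen hx
    refine (PrimeSpectrum.le_iff_specializes _ _).mp ?_
    intro a ha
    have ha' : i a ∈ y.asIdeal := ha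
    have hy : y.asIdeal = ⊥ := (Ideal.eq_bot_or_top _).resolve_right y.isPrime.ne_top
    rw [hy, Ideal.mem_bot, map_eq_zero_iff i hi] at ha'
    rw [ha']
    exact Ideal.zero_mem _
  refine ⟨IsOpenImmersion.lift U.ι _ hrange ≫ inv (g ∣_ U) ≫ (g ⁻¹ᵁ U).ι, ?_⟩
  rw [Category.assoc, Category.assoc, ← morphismRestrict_ι, IsIso.inv_hom_id_assoc,
    IsOpenImmersion.lift_fac]

/-- A valuation ring point of the base, dominant at the generic point, factors through a local
ring of a proper birational modification. -/
lemma exists_stalk_of_isProper {A O : Type u} [CommRing A] [IsDomain A] [CommRing O]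
    [IsDomain O] [ValuationRing O] (i : A →+* O) (hi : Function.Injective i) {Y : Scheme.{u}}
    (g : Y ⟶ Spec (CommRingCat.of A)) [IsProper g] (hg : IsBirationalMor g) :
    ∃ (y : Y) (α : A →+* Y.presheaf.stalk y) (ρ : Y.presheaf.stalk y →+* O),
      IsLocalHom ρ ∧ ρ.comp α = i := by
  obtain ⟨l₀, hl₀⟩ := exists_lift_of_isBirationalMor ((algebraMap O (FractionRing O)).comp i)
    ((IsFractionRing.injective O (FractionRing O)).comp hi) g hg
  have hval : ValuativeCriterion g := by
    have : IsProper g := inferInstance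
    rw [IsProper.eq_valuativeCriterion] at this
    exact this.1.1.1
  let S : ValuativeCommSq g :=
    { R := O
      K := FractionRing O
      i₁ := l₀
      i₂ := Spec.map (CommRingCat.ofHom i)
      commSq := ⟨by rw [hl₀, ← Spec.map_comp]; rfl⟩ }
  obtain ⟨l, -, hl⟩ := (hval.existence S).exists_lift
  have hl' : l ≫ g = Spec.map (CommRingCat.ofHom i) := hl
  let y : Y := l (IsLocalRing.closedPoint O)
  let ρ := Scheme.stalkClosedPointTo (R := CommRingCat.of O) l
  have hρ : Spec.map ρ ≫ Y.fromSpecStalk y = l :=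
    Scheme.Spec_stalkClosedPointTo_fromSpecStalk (R := CommRingCat.of O) l
  obtain ⟨α, hα⟩ := Spec.map_surjective (Y.fromSpecStalk y ≫ g)
  refine ⟨y, α.hom, ρ.hom, Scheme.isLocalHom_stalkClosedPointTo' l, ?_⟩
  have h : α ≫ ρ = CommRingCat.ofHom i := by
    apply Spec.map_injective
    rw [Spec.map_comp, hα, ← Category.assoc, hρ, hl']
  exact congrArg CommRingCat.Hom.hom h

/-- The spectrum of a finitely generated domain over a field is a variety. -/
lemma isVariety_Spec (F A : Type u) [Field F] [CommRing A] [IsDomain A] [Algebra F A]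
    [Algebra.FiniteType F A] :
    IsVariety (Spec.map (CommRingCat.ofHom (algebraMap F A))) := by
  refine ⟨inferInstance, inferInstance, ?_, inferInstance⟩
  rw [HasRingHomProperty.Spec_iff (P := @LocallyOfFiniteType)]
  exact (RingHom.finiteType_algebraMap).mpr inferInstance

/-- Let `A` be a finitely generated domain over `F` of dimension at most `n`, embedded in a
valuation ring with residue field `F`. If resolution of singularities holds up to dimension `n`, then every
nonzero element of `A` survives under some `F`-algebra map to the power series ring. -/
theorem exists_algHom_powerSeries_of_resolution {n : ℕ} (hres : ResolutionUpTo.{u} n)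
    {F A O : Type u} [Field F] [Infinite F] [CommRing A] [IsDomain A] [Algebra F A]
    [Algebra.FiniteType F A] (hdim : ringKrullDim A ≤ (n : ℕ∞)) [CommRing O] [IsDomain O]
    [ValuationRing O] [Algebra F O]
    (hO : ∀ x : O, ∃ c : F, x - algebraMap F O c ∈ IsLocalRing.maximalIdeal O)
    (i : A →ₐ[F] O) (hi : Function.Injective i) {f : A} (hf : f ≠ 0) :
    ∃ φ : A →ₐ[F] PowerSeries F, φ f ≠ 0 := by
  obtain ⟨Y, g, -, hreg, hprop, hbir⟩ := hres F _ _ (isVariety_Spec F A)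
    (by
      refine le_trans (le_of_eq ?_) hdim
      exact PrimeSpectrum.topologicalKrullDim_eq_ringKrullDim A)
  obtain ⟨y, α, ρ, hρ, hρα⟩ := exists_stalk_of_isProper (i : A →+* O) hi g hbir
  obtain ⟨hloc, hnoeth, s, hspan, hcard⟩ := hreg y
  let _ : Algebra F (Y.presheaf.stalk y) := (α.comp (algebraMap F A)).toAlgebra
  have hρF : ∀ c : F, ρ (algebraMap F _ c) = algebraMap F O c := fun c => by
    rw [RingHom.algebraMap_toAlgebra, RingHom.comp_apply, ← RingHom.comp_apply ρ, hρα]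
    exact i.commutes c
  have hραf : ρ (α f) = i f := by rw [← RingHom.comp_apply, hρα]; rfl
  obtain ⟨φ, hφ⟩ := exists_algHom_powerSeries_of_regular (F := F) (R := Y.presheaf.stalk y)
    (fun r => by
      obtain ⟨c, hc⟩ := hO (ρ r)
      refine ⟨c, ?_⟩
      rw [← hρF, ← map_sub] at hc
      intro hu
      exact hc (hu.map ρ)) s hspan hcard (f := α f)
    (fun h => hf (hi (by rw [← hραf, h, map_zero, map_zero])))
  exact ⟨{ (φ : Y.presheaf.stalk y →+* PowerSeries F).comp α with
    commutes' := fun c => φ.commutes c }, hφ⟩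

/-- A proper closed subset of affine `(n + 1)`-space has dimension at most `n`. -/
lemma ringKrullDim_quotient_mvPolynomial_le {F : Type*} [Field F] {l n : ℕ} (hl : l ≤ n + 1)
    {I : Ideal (MvPolynomial (Fin l) F)} (hI : I ≠ ⊥) :
    ringKrullDim (MvPolynomial (Fin l) F ⧸ I) ≤ (n : ℕ∞) := by
  obtain ⟨p, hp, hp0⟩ := Submodule.exists_mem_ne_zero_of_ne_bot hI
  have h := ringKrullDim_quotient_succ_le_of_nonZeroDivisor (mem_nonZeroDivisors_of_ne_zero hp0)
  rw [MvPolynomial.ringKrullDim_of_isNoetherianRing, ringKrullDim_eq_zero_of_field, zero_add,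
    Nat.card_eq_fintype_card, Fintype.card_fin] at h
  have h2 : ringKrullDim (MvPolynomial (Fin l) F ⧸ I) ≤
      ringKrullDim (MvPolynomial (Fin l) F ⧸ Ideal.span {p}) :=
    ringKrullDim_le_of_surjective
      (Ideal.Quotient.factor ((Ideal.span_singleton_le_iff_mem I).mpr hp))
      (Ideal.Quotient.factor_surjective _)
  have h3 : ringKrullDim (MvPolynomial (Fin l) F ⧸ I) + 1 ≤ (n : WithBot ℕ∞) + 1 :=
    (add_le_add_left h2 1).trans (h.trans (by exact_mod_cast hl))
  exact ENat.WithBot.add_le_add_natCast_right_iff.mp h3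

/-- An integral point over a residually rational valued field specializes to a point over the
Laurent series field at which a prescribed polynomial does not vanish. -/
theorem exists_laurentSeries_point_of_integral {n : ℕ} (hres : ResolutionUpTo.{u} n)
    {F E : Type u} [Field F] [Infinite F] [Field E] [Algebra F E]
    {Γ : Type*} [LinearOrderedCommGroupWithZero Γ] (w : Valuation E Γ)
    (htriv : ∀ c : F, w (algebraMap F E c) ≤ 1)
    (hresid : ∀ y : E, w y ≤ 1 → ∃ c : F, w (y - algebraMap F E c) < 1)
    {l : ℕ} (hl : l ≤ n + 1) (y : Fin l → E) (hy : ∀ i, w (y i) ≤ 1)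
    (f : MvPolynomial (Fin l) F) (hf : MvPolynomial.aeval y f ≠ 0) :
    ∃ y' : Fin l → LaurentSeries F,
      (∀ p : MvPolynomial (Fin l) F, MvPolynomial.aeval y p = 0 → MvPolynomial.aeval y' p = 0) ∧
      MvPolynomial.aeval y' f ≠ 0 := by
  suffices H : ∃ y' : Fin l → PowerSeries F,
      (∀ p : MvPolynomial (Fin l) F, MvPolynomial.aeval y p = 0 → MvPolynomial.aeval y' p = 0) ∧
      MvPolynomial.aeval y' f ≠ 0 by
    obtain ⟨y', h1, h2⟩ := H
    let e : PowerSeries F →ₐ[F] LaurentSeries F :=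
      { HahnSeries.ofPowerSeries ℤ F with
        commutes' := fun c => (HahnSeries.algebraMap_apply' ℤ c).symm }
    refine ⟨fun i => e (y' i), fun p hp => ?_, ?_⟩
    · rw [← MvPolynomial.comp_aeval_apply, h1 p hp, map_zero]
    · rw [← MvPolynomial.comp_aeval_apply]
      exact (map_ne_zero_iff e HahnSeries.ofPowerSeries_injective).mpr h2
  by_cases hind : ∀ p : MvPolynomial (Fin l) F, MvPolynomial.aeval y p = 0 → p = 0
  · obtain ⟨c, hc⟩ : ∃ c : Fin l → F, MvPolynomial.eval c f ≠ 0 := by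
      by_contra! h
      refine hf ?_
      rw [MvPolynomial.funext (p := f) (q := 0) fun c => by simpa using h c, map_zero]
    refine ⟨fun i => algebraMap F _ (c i), fun p hp => by rw [hind p hp, map_zero], ?_⟩
    have : MvPolynomial.aeval (fun i => algebraMap F (PowerSeries F) (c i)) f =
        algebraMap F (PowerSeries F) (MvPolynomial.aeval c f) :=
      MvPolynomial.aeval_algebraMap_apply _ _ _
    rw [this]
    exact (map_ne_zero_iff _ (algebraMap F (PowerSeries F)).injective).mpr hc
  · push Not at hind
    obtain ⟨q, hq, hq0⟩ := hind
    let ι : F →+* w.valuationSubring :=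
      (algebraMap F E).codRestrict w.valuationSubring.toSubring htriv
    let _ : Algebra F w.valuationSubring := ι.toAlgebra
    let v : w.valuationSubring →ₐ[F] E :=
      { w.valuationSubring.subtype with commutes' := fun _ => rfl }
    have hv : Function.Injective v := Subtype.val_injective
    let y₀ : Fin l → w.valuationSubring := fun i => ⟨y i, hy i⟩
    let a : MvPolynomial (Fin l) F →ₐ[F] w.valuationSubring := MvPolynomial.aeval y₀
    have hva : ∀ p, v (a p) = MvPolynomial.aeval y p := fun p => by
      rw [MvPolynomial.comp_aeval_apply]; rfl
    have ha0 : ∀ p, a p = 0 ↔ MvPolynomial.aeval y p = 0 := fun p => by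
      rw [← hva, map_eq_zero_iff v hv]
    have hprime : (RingHom.ker a).IsPrime := RingHom.ker_isPrime a
    obtain ⟨φ, hφ⟩ := exists_algHom_powerSeries_of_resolution hres
      (F := F) (A := MvPolynomial (Fin l) F ⧸ RingHom.ker a) (O := w.valuationSubring)
      (ringKrullDim_quotient_mvPolynomial_le hl
        (fun h => hq0 (by
          have : q ∈ RingHom.ker a := (ha0 q).mpr hq
          rwa [h, Ideal.mem_bot] at this)))
      (fun x => by
        obtain ⟨c, hc⟩ := hresid x x.2
        exact ⟨c, (Valuation.mem_maximalIdeal_iff E w).mpr hc⟩)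
      (Ideal.kerLiftAlg a) (Ideal.kerLiftAlg_injective a)
      (f := Ideal.Quotient.mk _ f)
      (fun h => hf ((ha0 f).mp (Ideal.Quotient.eq_zero_iff_mem.mp h)))
    let ψ : MvPolynomial (Fin l) F →ₐ[F] PowerSeries F := φ.comp (Ideal.Quotient.mkₐ F _)
    have hψ : ∀ p, MvPolynomial.aeval (fun i => ψ (MvPolynomial.X i)) p = ψ p := fun p =>
      (DFunLike.congr_fun (MvPolynomial.aeval_unique ψ) p).symm
    refine ⟨fun i => ψ (MvPolynomial.X i), fun p hp => ?_, ?_⟩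
    · rw [hψ]
      have : Ideal.Quotient.mk (RingHom.ker a) p = 0 :=
        Ideal.Quotient.eq_zero_iff_mem.mpr ((ha0 p).mpr hp)
      exact (congrArg φ this).trans (map_zero φ)
    · rw [hψ]
      exact hφ

/-- Clearing denominators after inverting some of the variables. -/
lemma exists_clear_denominators {F : Type*} [Field F] {σ : Type*} [Fintype σ] (I : σ → Prop)
    [DecidablePred I] (p : MvPolynomial σ F) :
    ∃ (q : MvPolynomial σ F) (N : ℕ), ∀ (M : Type u) [Field M] [Algebra F M] (y : σ → M),
      (∀ i, I i → y i ≠ 0) →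
      MvPolynomial.aeval y q =
        MvPolynomial.aeval (fun i => if I i then (y i)⁻¹ else y i) p *
          (∏ i with I i, y i) ^ N := by
  classical
  induction p using MvPolynomial.induction_on with
  | C a => exact ⟨MvPolynomial.C a, 0, fun M _ _ y _ => by simp⟩
  | add p₁ p₂ h₁ h₂ =>
    obtain ⟨q₁, N₁, h₁⟩ := h₁
    obtain ⟨q₂, N₂, h₂⟩ := h₂
    refine ⟨q₁ * (∏ i with I i, MvPolynomial.X i) ^ N₂ +
      q₂ * (∏ i with I i, MvPolynomial.X i) ^ N₁, N₁ + N₂, fun M _ _ y hy => ?_⟩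
    simp only [map_add, map_mul, map_pow, map_prod, MvPolynomial.aeval_X, h₁ M y hy, h₂ M y hy]
    ring
  | mul_X p i h =>
    obtain ⟨q, N, h⟩ := h
    by_cases hi : I i
    · refine ⟨q * ∏ j ∈ (Finset.univ.filter I).erase i, MvPolynomial.X j, N + 1,
        fun M _ _ y hy => ?_⟩
      simp only [map_mul, map_prod, MvPolynomial.aeval_X, h M y hy, if_pos hi, pow_succ]
      rw [← Finset.mul_prod_erase (Finset.univ.filter I) y (a := i) (by simp [hi])]
      have := hy i hi
      field_simp
    · refine ⟨q * MvPolynomial.X i, N, fun M _ _ y hy => ?_⟩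
      simp only [map_mul, MvPolynomial.aeval_X, h M y hy, if_neg hi]
      ring

/-- A tuple of length at most `n + 1` over a residually rational valued field can be replaced by one
over the Laurent series field at which the same members of a given finite set of polynomials
vanish, provided resolution of singularities holds up to dimension `n`. -/
theorem exists_laurentSeries_point {n : ℕ} (hres : ResolutionUpTo.{u} n)
    {F E : Type u} [Field F] [Infinite F] [Field E] [Algebra F E]
    {Γ : Type*} [LinearOrderedCommGroupWithZero Γ] (w : Valuation E Γ)
    (htriv : ∀ c : F, w (algebraMap F E c) ≤ 1)
    (hresid : ∀ y : E, w y ≤ 1 → ∃ c : F, w (y - algebraMap F E c) < 1)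
    {l : ℕ} (hl : l ≤ n + 1) (x : Fin l → E) (Q : Finset (MvPolynomial (Fin l) F)) :
    ∃ x' : Fin l → LaurentSeries F, ∀ p ∈ Q,
      MvPolynomial.aeval x p = 0 ↔ MvPolynomial.aeval x' p = 0 := by
  classical
  let I : Fin l → Prop := fun i => ¬ w (x i) ≤ 1
  have hx0 : ∀ i, I i → x i ≠ 0 := fun i hi h => hi (by rw [h, map_zero]; exact zero_le_one)
  let y : Fin l → E := fun i => if I i then (x i)⁻¹ else x i
  have hyI : ∀ i, I i → y i ≠ 0 := fun i hi => by
    simpa [y, hi] using hx0 i hi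
  have hxy : x = fun i => if I i then (y i)⁻¹ else y i := by
    ext i
    by_cases hi : I i <;> simp [y, hi]
  have hy : ∀ i, w (y i) ≤ 1 := fun i => by
    by_cases hi : I i
    · simp only [y, if_pos hi, map_inv₀]
      exact inv_le_one_of_one_le₀ (not_le.mp hi).le
    · simpa only [y, if_neg hi] using not_not.mp hi
  choose q N hq using fun p : MvPolynomial (Fin l) F => exists_clear_denominators.{u} I p
  have hclear : ∀ (M : Type u) [Field M] [Algebra F M] (z : Fin l → M), (∀ i, I i → z i ≠ 0) →
      ∀ p, MvPolynomial.aeval z (q p) = 0 ↔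
        MvPolynomial.aeval (fun i => if I i then (z i)⁻¹ else z i) p = 0 := by
    intro M _ _ z hz p
    rw [hq p M z hz, mul_eq_zero, or_iff_left]
    exact pow_ne_zero _ (Finset.prod_ne_zero_iff.mpr fun i hi => hz i (by simpa using hi))
  obtain ⟨y', hy', hf⟩ := exists_laurentSeries_point_of_integral hres w htriv hresid hl y hy
    ((∏ i with I i, MvPolynomial.X i) *
      ∏ p ∈ Q with MvPolynomial.aeval x p ≠ 0, q p)
    (by
      rw [map_mul, map_prod, map_prod]
      refine mul_ne_zero (Finset.prod_ne_zero_iff.mpr fun i hi => ?_)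
        (Finset.prod_ne_zero_iff.mpr fun p hp => ?_)
      · rw [MvPolynomial.aeval_X]
        exact hyI i (by simpa using hi)
      · rw [Ne, hclear E y hyI, ← hxy]
        exact (Finset.mem_filter.mp hp).2)
  rw [map_mul, map_prod, map_prod] at hf
  have hf1 : ∀ i, I i → y' i ≠ 0 := fun i hi => by
    have := Finset.prod_ne_zero_iff.mp (left_ne_zero_of_mul hf) i (by simpa using hi)
    rwa [MvPolynomial.aeval_X] at this
  refine ⟨fun i => if I i then (y' i)⁻¹ else y' i, fun p hp => ?_⟩
  rw [← hclear _ y' hf1]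
  constructor
  · intro h
    apply hy'
    rwa [hclear E y hyI, ← hxy]
  · intro h
    by_contra h0
    exact Finset.prod_ne_zero_iff.mp (right_ne_zero_of_mul hf) p
      (Finset.mem_filter.mpr ⟨hp, h0⟩) h

/-- Every term in the language of rings with constants from `F` is given by a polynomial
over `F`. -/
theorem exists_mvPolynomial_realize_term {F : Type*} [Field F] {k : ℕ}
    (t : (Language.ring[[F]]).Term (Empty ⊕ Fin k)) :
    ∃ p : MvPolynomial (Fin k) F, ∀ (M : Type u) [CommRing M] [Algebra F M] (v : Empty → M)
      (x : Fin k → M),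
      @Term.realize _ M (ringConStructure (algebraMap F M)) _ (Sum.elim v x) t =
        MvPolynomial.aeval x p := by
  induction t with
  | var i =>
    rcases i with i | i
    · exact i.elim
    · exact ⟨MvPolynomial.X i, fun M _ _ v x => by simp⟩
  | @func m f ts ih =>
    choose p hp using ih
    rcases f with f | f
    · cases f with
      | add =>
        exact ⟨p 0 + p 1, fun M _ _ v x => by rw [map_add, ← hp 0 M v, ← hp 1 M v]; rfl⟩
      | mul =>
        exact ⟨p 0 * p 1, fun M _ _ v x => by rw [map_mul, ← hp 0 M v, ← hp 1 M v]; rfl⟩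
      | neg => exact ⟨-p 0, fun M _ _ v x => by rw [map_neg, ← hp 0 M v]; rfl⟩
      | zero => exact ⟨0, fun M _ _ v x => by rw [map_zero]; rfl⟩
      | one => exact ⟨1, fun M _ _ v x => by rw [map_one]; rfl⟩
    · cases m with
      | zero => exact ⟨MvPolynomial.C f, fun M _ _ v x =>
          (MvPolynomial.aeval_C (R := F) x f).symm⟩
      | succ m => exact f.elim

/-- The truth of a quantifier-free formula in the language of rings with constants from `F` at a
tuple is determined by which members of a suitable finite set of polynomials vanish there. -/
theorem exists_finset_realize_iff_of_isQF {F : Type*} [Field F] {k : ℕ}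
    {φ : (Language.ring[[F]]).BoundedFormula Empty k} (hφ : φ.IsQF) :
    ∃ Q : Finset (MvPolynomial (Fin k) F),
      ∀ (M M' : Type u) [CommRing M] [CommRing M'] [Algebra F M] [Algebra F M']
        (v : Empty → M) (v' : Empty → M') (x : Fin k → M) (x' : Fin k → M'),
        (∀ p ∈ Q, MvPolynomial.aeval x p = 0 ↔ MvPolynomial.aeval x' p = 0) →
        (@BoundedFormula.Realize _ M (ringConStructure (algebraMap F M)) _ _ φ v x ↔
          @BoundedFormula.Realize _ M' (ringConStructure (algebraMap F M')) _ _ φ v' x') := by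
  classical
  induction hφ with
  | falsum => exact ⟨∅, fun M M' _ _ _ _ v v' x x' _ => Iff.rfl⟩
  | of_isAtomic h =>
    cases h with
    | equal t₁ t₂ =>
      obtain ⟨p₁, h₁⟩ := exists_mvPolynomial_realize_term.{u} t₁
      obtain ⟨p₂, h₂⟩ := exists_mvPolynomial_realize_term.{u} t₂
      refine ⟨{p₁ - p₂}, fun M M' _ _ _ _ v v' x x' h => ?_⟩
      have := h _ (Finset.mem_singleton_self _)
      rw [map_sub, map_sub, sub_eq_zero, sub_eq_zero] at this
      rw [← h₁ M v, ← h₂ M v, ← h₁ M' v', ← h₂ M' v'] at this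
      exact this
    | rel R ts =>
      rcases R with R | R <;> exact R.elim
  | imp _ _ ih₁ ih₂ =>
    obtain ⟨Q₁, h₁⟩ := ih₁
    obtain ⟨Q₂, h₂⟩ := ih₂
    refine ⟨Q₁ ∪ Q₂, fun M M' _ _ _ _ v v' x x' h => ?_⟩
    exact imp_congr (h₁ M M' v v' x x' fun p hp => h p (Finset.mem_union_left _ hp))
      (h₂ M M' v v' x x' fun p hp => h p (Finset.mem_union_right _ hp))

/-- A realization of an `∃_n`-formula in the language of rings with constants from `F` is
witnessed by a tuple, and transfers along any tuple at which the same members of a suitable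
finite set of polynomials vanish. -/
theorem IsExistsN.exists_transfer {F E : Type u} [Field F] [CommRing E] [Algebra F E] {n k : ℕ}
    {φ : (Language.ring[[F]]).BoundedFormula Empty k} (hφ : IsExistsN n φ) (v : Empty → E)
    (a : Fin k → E)
    (h : @BoundedFormula.Realize _ E (ringConStructure (algebraMap F E)) _ _ φ v a) :
    ∃ l ≤ k + n, ∃ (e : Fin k → Fin l) (x : Fin l → E) (Q : Finset (MvPolynomial (Fin l) F)),
      ∀ (M : Type u) [CommRing M] [Algebra F M] (v' : Empty → M) (x' : Fin l → M),
        (∀ p ∈ Q, MvPolynomial.aeval x p = 0 ↔ MvPolynomial.aeval x' p = 0) →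
        @BoundedFormula.Realize _ M (ringConStructure (algebraMap F M)) _ _ φ v' (x' ∘ e) := by
  induction hφ with
  | @qf n k φ hφ =>
    obtain ⟨Q, hQ⟩ := exists_finset_realize_iff_of_isQF.{u} hφ
    exact ⟨k, Nat.le_add_right _ _, id, a, Q, fun M _ _ v' x' hx =>
      (hQ E M v v' a x' hx).mp h⟩
  | @ex n k φ _ ih =>
    obtain ⟨b, hb⟩ := (@BoundedFormula.realize_ex _ _ (ringConStructure (algebraMap F E))
      _ _ _ _ _).mp h
    obtain ⟨l, hl, e, x, Q, hQ⟩ := ih _ hb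
    refine ⟨l, by omega, e ∘ Fin.castSucc, x, Q, fun M _ _ v' x' hx => ?_⟩
    refine (@BoundedFormula.realize_ex _ _ (ringConStructure (algebraMap F M))
      _ _ _ _ _).mpr ⟨x' (e (Fin.last k)), ?_⟩
    convert hQ M v' x' hx using 1
    ext i
    refine Fin.lastCases ?_ (fun j => ?_) i <;> simp

/-- Over a field `F`, avoiding finitely many elements of `F` is a quantifier-free condition. -/
theorem exists_isQF_realize_iff_forall_ne {F : Type*} [Field F] (s : Finset F) :
    ∃ φ : (Language.ring[[F]]).BoundedFormula Empty 1, φ.IsQF ∧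
      ∀ (M : Type u) [CommRing M] [Algebra F M] (v : Empty → M) (x : Fin 1 → M),
        @BoundedFormula.Realize _ M (ringConStructure (algebraMap F M)) _ _ φ v x ↔
          ∀ c ∈ s, x 0 ≠ algebraMap F M c := by
  classical
  induction s using Finset.induction_on with
  | empty => exact ⟨⊤, BoundedFormula.IsQF.top, fun M _ _ v x => by simp⟩
  | insert c s _ ih =>
    obtain ⟨φ, hφ, h⟩ := ih
    let t : (Language.ring[[F]]).Term (Empty ⊕ Fin 1) := (Language.ring.con c).term
    refine ⟨(Term.bdEqual (Term.var (Sum.inr 0)) t).not ⊓ φ,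
      (BoundedFormula.IsAtomic.equal _ _).isQF.not.inf hφ, fun M _ _ v x => ?_⟩
    rw [@BoundedFormula.realize_inf _ _ (ringConStructure (algebraMap F M)), h M v x,
      @BoundedFormula.realize_not _ _ (ringConStructure (algebraMap F M)),
      Finset.forall_mem_insert]
    exact Iff.rfl

/-- Every large field is infinite. -/
theorem LargeField.infinite {F : Type u} [Field F] (hF : LargeField F) : Infinite F := by
  refine not_finite_iff_infinite.mp fun hfin => ?_
  have := Fintype.ofFinite F
  obtain ⟨φ, hφ, h⟩ := exists_isQF_realize_iff_forall_ne.{u} (Finset.univ : Finset F)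
  have hex := hF φ.ex ⟨1, .ex (.qf hφ)⟩
    ((@BoundedFormula.realize_ex _ _ (ringConStructure (algebraMap F (LaurentSeries F)))
      _ _ _ _ _).mpr ⟨HahnSeries.ofPowerSeries ℤ F PowerSeries.X, (h _ _ _).mpr fun c _ hc => ?_⟩)
  · obtain ⟨c, hc⟩ := (@BoundedFormula.realize_ex _ _ (ringConStructure (algebraMap F F))
      _ _ _ _ _).mp hex
    exact (h _ _ _).mp hc c (Finset.mem_univ _) rfl
  · have hX : (PowerSeries.X : PowerSeries F) = algebraMap F (PowerSeries F) c :=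
      HahnSeries.ofPowerSeries_injective (hc.trans (HahnSeries.algebraMap_apply' ℤ c))
    have := congrArg (PowerSeries.coeff 1) hX
    simp at this

/-- If resolution of singularities holds up to dimension `n`, then every `∃_{n+1}`-sentence over an
infinite field `F` that is true in a residually rational valued extension of `F`, with valuation
trivial on `F`, is true in the Laurent series field over `F`. -/
theorem realizeRing_laurentSeries {n : ℕ} (hres : ResolutionUpTo.{u} n)
    {F E : Type u} [Field F] [Infinite F] [Field E] [Algebra F E]
    {Γ : Type*} [LinearOrderedCommGroupWithZero Γ] (w : Valuation E Γ)
    (htriv : ∀ c : F, w (algebraMap F E c) ≤ 1)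
    (hresid : ∀ y : E, w y ≤ 1 → ∃ c : F, w (y - algebraMap F E c) < 1)
    {φ : (Language.ring[[F]]).Sentence} (hφ : IsExistsN (n + 1) φ)
    (hE : RealizeRing E (algebraMap F E) φ) :
    RealizeRing (LaurentSeries F) (algebraMap F (LaurentSeries F)) φ := by
  obtain ⟨l, hl, e, x, Q, hQ⟩ := hφ.exists_transfer _ _ hE
  obtain ⟨x', hx'⟩ := exists_laurentSeries_point hres w htriv hresid
    (hl.trans (Nat.zero_add _).le) x Q
  have h := hQ (LaurentSeries F) default x' hx'
  rw [Subsingleton.elim (x' ∘ e) default] at h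
  unfold RealizeRing Sentence.Realize Formula.Realize
  convert h

/-- essentially Lemma `prop` + Proposition of Section 7 of the paper.
If resolution of singularities holds up to dimension `n`, then `(R4_{n+1})` holds. -/
theorem statement18 (n : ℕ) (hres : ResolutionUpTo.{u} n) : R4N.{u} (n + 1) := by
  intro E _ Γ _ w F hlarge htriv hresid φ hφ hE
  have := hlarge.infinite
  refine hlarge φ ⟨n + 1, hφ⟩
    (realizeRing_laurentSeries hres w (fun c => ?_) hresid hφ hE)
  by_cases hc : (c : E) = 0
  · exact (congrArg w hc).trans_le ((map_zero w).trans_le zero_le_one)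
  · exact (htriv c hc).le

end Paper
end
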